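/- arXiv:1707.07365 — 2 statements merged into one kernel-verified Lean document; each statement's English description precedes it below -/
import Mathlib

section
/- A simple 3-polytope P (other than the simplex) is a Pogorelov polytope if and only if each pair of adjacent facets of P is surrounded by a belt; moreover if the two facets have k₁ and k₂ edges, the surrounding belt has length k₁ + k₂ − 4. -/
/-- An abstract simplicial complex on vertex type `V` (with the empty face included). -/
structure SC (V : Type) where
  faces : Set (Finset V)
  empty_mem : ∅ ∈ faces
  down_closed : ∀ s ∈ faces, ∀ t ⊆ s, t ∈ faces

variable {V : Type}
section Sphere
variable [DecidableEq V]

/-- The degree of a vertex: the number of vertices adjacent to it. Dually, the number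
of edges of the facet of the simple 3-polytope corresponding to `v`. -/
noncomputable def SC.vdeg (K : SC V) (v : V) : ℕ :=
  Set.ncard {u | u ≠ v ∧ ({v, u} : Finset V) ∈ K.faces}

/-- `K` is a simplicial 2-sphere: pure 2-dimensional, every vertex present, each edge in
exactly two triangles, vertex links connected, connected, and Euler characteristic 2.
Dually, the boundary complex of a simple 3-polytope. -/
def IsSphere2 [Fintype V] (K : SC V) : Prop :=
  (∀ v : V, ({v} : Finset V) ∈ K.faces) ∧
  (∀ s ∈ K.faces, s.card ≤ 3) ∧
  (∀ s ∈ K.faces, ∃ t ∈ K.faces, s ⊆ t ∧ t.card = 3) ∧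
  (∀ e ∈ K.faces, e.card = 2 → Set.ncard {t | t ∈ K.faces ∧ t.card = 3 ∧ e ⊆ t} = 2) ∧
  (∀ (v : V) (t t' : Finset V), t ∈ K.faces → t' ∈ K.faces → t.card = 3 → t'.card = 3 →
    v ∈ t → v ∈ t' →
    Relation.ReflTransGen
      (fun a b => a ∈ K.faces ∧ b ∈ K.faces ∧ a.card = 3 ∧ b.card = 3 ∧
        v ∈ a ∧ v ∈ b ∧ (a ∩ b).card = 2) t t') ∧
  (∀ u w : V, Relation.ReflTransGen (fun a b => a ≠ b ∧ ({a, b} : Finset V) ∈ K.faces) u w) ∧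
  ((Set.ncard {s | s ∈ K.faces ∧ s.card = 1} : ℤ)
    - (Set.ncard {s | s ∈ K.faces ∧ s.card = 2} : ℤ)
    + (Set.ncard {s | s ∈ K.faces ∧ s.card = 3} : ℤ) = 2)

/-- `K` is flag: every nonempty collection of pairwise adjacent vertices spans a face.
Dually: every family of pairwise intersecting facets of `P` has a common point. -/
def IsFlag (K : SC V) : Prop :=
  ∀ s : Finset V, s.Nonempty → (∀ u ∈ s, ({u} : Finset V) ∈ K.faces) →
    (∀ u ∈ s, ∀ w ∈ s, u ≠ w → ({u, w} : Finset V) ∈ K.faces) → s ∈ K.faces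

/-- A `k`-belt, dually: a chordless cycle `f 0, f 1, …, f (k-1)` in `K` spanning no
2-simplex.  The corresponding facets are pairwise distinct and only consecutive ones
(in the cyclic order) intersect. -/
def IsBelt (K : SC V) (k : ℕ) (f : ZMod k → V) : Prop :=
  3 ≤ k ∧ Function.Injective f ∧
  (∀ i : ZMod k, ({f i, f (i + 1)} : Finset V) ∈ K.faces) ∧
  (∀ i j : ZMod k, i ≠ j → ({f i, f j} : Finset V) ∈ K.faces → (j = i + 1 ∨ i = j + 1)) ∧
  (∀ i j l : ZMod k, i ≠ j → j ≠ l → i ≠ l → ({f i, f j, f l} : Finset V) ∉ K.faces)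

/-- `P` has a `k`-belt of facets. -/
def HasBelt (K : SC V) (k : ℕ) : Prop := ∃ f : ZMod k → V, IsBelt K k f

/-- `K` is the boundary of the 3-simplex (dually, `P = Δ³`). -/
def IsSimplexBoundary (K : SC V) : Prop :=
  ∃ s : Finset V, s.card = 4 ∧ K.faces = {t | t ⊆ s ∧ t ≠ s}

/-- A Pogorelov polytope: a (simple 3-dimensional) flag polytope without 4-belts,
encoded via its dual simplicial 2-sphere. -/
def IsPogorelov (K : SC V) : Prop := IsFlag K ∧ ¬ HasBelt K 4

/-- The facet corresponding to `v`, having `K.vdeg v` edges, is surrounded by a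
`(K.vdeg v)`-belt consisting exactly of the facets adjacent to it. -/
def VertexSurrounded (K : SC V) (v : V) : Prop :=
  ∃ f : ZMod (K.vdeg v) → V, IsBelt K (K.vdeg v) f ∧
    Set.range f = {u | u ≠ v ∧ ({v, u} : Finset V) ∈ K.faces}

/-- Every 3-cycle of `K` bounds a face (no empty triangles). -/
def NoEmptyTriangle (K : SC V) : Prop :=
  ∀ a b c : V, a ≠ b → b ≠ c → a ≠ c →
    ({a, b} : Finset V) ∈ K.faces → ({b, c} : Finset V) ∈ K.faces →
    ({a, c} : Finset V) ∈ K.faces → ({a, b, c} : Finset V) ∈ K.faces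

/-- `K` contains a chordless 4-cycle. -/
def HasChordless4 (K : SC V) : Prop :=
  ∃ f : ZMod 4 → V, Function.Injective f ∧
    (∀ i : ZMod 4, ({f i, f (i + 1)} : Finset V) ∈ K.faces) ∧
    ({f 0, f 2} : Finset V) ∉ K.faces ∧ ({f 1, f 3} : Finset V) ∉ K.faces

end Sphere

/-- Adjacency relation and triangle relation of a closed surface, abstractly. -/
structure Surf (A : V → V → Prop) (T : V → V → V → Prop) : Prop where
  irr : ∀ x y, A x y → x ≠ y
  symm : ∀ x y, A x y → A y x
  t1 : ∀ x y z, T x y z → T y x z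
  t2 : ∀ x y z, T x y z → T x z y
  ta : ∀ x y z, T x y z → A x y
  edge : ∀ x y, A x y → ∃ a b, a ≠ b ∧ ∀ c, T x y c ↔ c = a ∨ c = b
  conn : ∀ u p q, A u p → A u q → Relation.ReflTransGen (T u) p q

/-- adjacency of the complex -/
def SC.A [DecidableEq V] (K : SC V) (x y : V) : Prop := x ≠ y ∧ ({x, y} : Finset V) ∈ K.faces
/-- triangles of the complex -/
def SC.T [DecidableEq V] (K : SC V) (x y z : V) : Prop :=
  x ≠ y ∧ x ≠ z ∧ y ≠ z ∧ ({x, y, z} : Finset V) ∈ K.faces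

lemma SC.T_of_mem [DecidableEq V] (K : SC V) {t : Finset V} (ht : t ∈ K.faces) (h3 : t.card = 3)
    {x y z : V} (hx : x ∈ t) (hy : y ∈ t) (hz : z ∈ t) (hxy : x ≠ y) (hxz : x ≠ z) (hyz : y ≠ z) :
    K.T x y z := by
  refine ⟨hxy, hxz, hyz, ?_⟩
  have : ({x, y, z} : Finset V) = t := by
    apply Finset.eq_of_subset_of_card_le
    · intro w; simp; rintro (rfl | rfl | rfl) <;> assumption
    · rw [h3, Finset.card_eq_three.2 ⟨x, y, z, hxy, hxz, hyz, rfl⟩]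
  rw [this]; exact ht

lemma surf_of_sphere [DecidableEq V] [Fintype V] (K : SC V) (hS : IsSphere2 K) :
    Surf K.A K.T := by
  obtain ⟨h1, h2, h3, h4, h5, -, -⟩ := hS
  have hthird : ∀ x y : V, x ≠ y → ∀ t ∈ K.faces, t.card = 3 → ({x, y} : Finset V) ⊆ t →
      ∃ c, c ≠ x ∧ c ≠ y ∧ t = {x, y, c} := by
    intro x y hxy t ht htc hs
    obtain ⟨c, hc⟩ : ∃ c, t \ {x, y} = {c} := by
      rw [← Finset.card_eq_one, Finset.card_sdiff_of_subset hs, htc, Finset.card_pair hxy]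
    have hct : c ∈ t \ {x, y} := by rw [hc]; simp
    simp only [Finset.mem_sdiff, Finset.mem_insert, Finset.mem_singleton, not_or] at hct
    refine ⟨c, hct.2.1, hct.2.2, ?_⟩
    rw [← Finset.sdiff_union_of_subset hs, hc]
    ext w; simp; tauto
  refine ⟨fun x y h => h.1, ?_, ?_, ?_, ?_, ?_, ?_⟩
  · rintro x y ⟨h, h'⟩; exact ⟨h.symm, by rwa [Finset.pair_comm]⟩
  · rintro x y z ⟨a, b, c, d⟩
    exact ⟨a.symm, c, b, by rwa [Finset.insert_comm]⟩
  · rintro x y z ⟨a, b, c, d⟩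
    exact ⟨b, a, c.symm, by rwa [Finset.pair_comm]⟩
  · rintro x y z ⟨a, b, c, d⟩
    exact ⟨a, K.down_closed _ d _ (by intro w; simp; tauto)⟩
  · rintro x y ⟨hxy, he⟩
    have := h4 _ he (Finset.card_pair hxy)
    obtain ⟨s, t, hst, hset⟩ := Set.ncard_eq_two.1 this
    have hs : s ∈ ({s, t} : Set (Finset V)) := by simp
    have ht : t ∈ ({s, t} : Set (Finset V)) := by simp
    rw [← hset] at hs ht
    obtain ⟨a, hax, hay, rfl⟩ := hthird x y hxy s hs.1 hs.2.1 hs.2.2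
    obtain ⟨b, hbx, hby, rfl⟩ := hthird x y hxy t ht.1 ht.2.1 ht.2.2
    refine ⟨a, b, fun h => hst (by rw [h]), fun c => ⟨?_, ?_⟩⟩
    · rintro ⟨p, q, r, hf⟩
      have : ({x, y, c} : Finset V) ∈ {t | t ∈ K.faces ∧ t.card = 3 ∧ {x, y} ⊆ t} :=
        ⟨hf, Finset.card_eq_three.2 ⟨x, y, c, p, q, r, rfl⟩, by intro w; simp; tauto⟩
      rw [hset] at this
      rcases this with h | h
      · left
        have : c ∈ ({x, y, a} : Finset V) := by rw [← h]; simp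
        simp at this; tauto
      · right
        have h : ({x, y, c} : Finset V) = {x, y, b} := h
        have : c ∈ ({x, y, b} : Finset V) := by rw [← h]; simp
        simp at this; tauto
    · rintro (rfl | rfl)
      · exact ⟨hxy, hax.symm, hay.symm, hs.1⟩
      · exact ⟨hxy, hbx.symm, hby.symm, ht.1⟩
  · rintro u p q ⟨hup, hp⟩ ⟨huq, hq⟩
    obtain ⟨t, ht, hst, htc⟩ := h3 _ hp
    obtain ⟨t', ht', hst', htc'⟩ := h3 _ hq
    have hin : ∀ t ∈ K.faces, t.card = 3 → u ∈ t → ∀ x ∈ t, ∀ y ∈ t, u ≠ x → u ≠ y →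
        Relation.ReflTransGen (K.T u) x y := by
      intro t ht htc hu x hx y hy hux huy
      by_cases hxy : x = y
      · subst hxy; exact .refl
      · exact .single (K.T_of_mem ht htc hu hx hy hux huy hxy)
    have hch := h5 u t t' ht ht' htc htc' (hst (by simp)) (hst' (by simp))
    have : ∀ y ∈ t', u ≠ y → Relation.ReflTransGen (K.T u) p y := by
      clear hst' hq huq
      induction hch with
      | refl => intro y hy huy; exact hin t ht htc (hst (by simp)) p (hst (by simp)) y hy hup huy
      | tail hab hbc ih =>
        rename_i b c
        intro y hy huy
        obtain ⟨hb, hc, hbcard, hccard, hub, huc, hint⟩ := hbc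
        obtain ⟨z, hz, hzu⟩ := Finset.exists_mem_ne (by omega : 1 < (b ∩ c).card) u
        rw [Finset.mem_inter] at hz
        exact (ih hb hbcard z hz.1 hzu.symm).trans
          (hin c hc hccard huc z hz.2 y hy hzu.symm huy)
    exact this q (hst' (by simp)) huq

/-- A connected 2-regular graph on a subset is a cycle. -/
lemma exists_cycle_param [Fintype V] (G : SimpleGraph V) (hG : G.IsCycles) (S : Set V) (a : V)
    (ha : a ∈ S) (hne : (G.neighborSet a).Nonempty)
    (hin : ∀ x y, G.Adj x y → x ∈ S) (hconn : ∀ x ∈ S, G.Reachable a x) :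
    3 ≤ S.ncard ∧ ∃ f : ZMod S.ncard → V, Function.Injective f ∧ Set.range f = S ∧
      (∀ i, G.Adj (f i) (f (i + 1))) ∧
      (∀ i j, G.Adj (f i) (f j) → j = i + 1 ∨ i = j + 1) := by
  obtain ⟨p, hp, hv⟩ := hG.exists_cycle_toSubgraph_verts_eq_connectedComponentSupp
    (c := G.connectedComponentMk a) (v := a) rfl hne
  have hsupp : ∀ x, x ∈ p.support ↔ x ∈ S := by
    intro x
    rw [← SimpleGraph.Walk.mem_verts_toSubgraph, hv]
    simp only [SimpleGraph.ConnectedComponent.mem_supp_iff, SimpleGraph.ConnectedComponent.eq]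
    constructor
    · intro h
      obtain ⟨w⟩ := h
      cases w with
      | nil => exact ha
      | cons h w => exact hin _ _ h
    · intro h; exact (hconn x h).symm
  have h3 := hp.three_le_length
  have hinj := hp.getVert_injOn'
  have hrange : (p.getVert '' {i | i ≤ p.length - 1}) = S := by
    ext x
    rw [← hsupp, SimpleGraph.Walk.mem_support_iff_exists_getVert]
    constructor
    · rintro ⟨i, hi, rfl⟩
      exact ⟨i, rfl, by simp at hi; omega⟩
    · rintro ⟨i, rfl, hi⟩
      by_cases h : i = p.length
      · exact ⟨0, by simp, by simp [h]⟩
      · exact ⟨i, by simp; omega, rfl⟩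
  have hcard : S.ncard = p.length := by
    rw [← hrange, Set.ncard_image_of_injOn hinj]
    have : {i | i ≤ p.length - 1} = ((Finset.range p.length : Finset ℕ) : Set ℕ) := by
      ext i; simp; omega
    rw [this, Set.ncard_coe_finset, Finset.card_range]
  rw [hcard]
  haveI : NeZero p.length := ⟨by omega⟩
  haveI : Fact (1 < p.length) := ⟨by omega⟩
  have finj : Function.Injective (fun i : ZMod p.length => p.getVert i.val) := by
    intro i j hij
    have hi := i.val_lt
    have hj := j.val_lt
    exact ZMod.val_injective _ (hinj (by simp; omega) (by simp; omega) hij)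
  have fadj : ∀ i : ZMod p.length, G.Adj (p.getVert i.val) (p.getVert (i + 1).val) := by
    intro i
    have hi := i.val_lt
    have := p.adj_getVert_succ hi
    rw [ZMod.val_add, ZMod.val_one]
    by_cases h : i.val + 1 = p.length
    · rw [h, Nat.mod_self]; rw [h] at this; simpa using this
    · rw [Nat.mod_eq_of_lt (by omega)]; exact this
  refine ⟨h3, fun i => p.getVert i.val, finj, ?_, fadj, ?_⟩
  · rw [← hrange]
    ext x; constructor
    · rintro ⟨i, rfl⟩
      exact ⟨i.val, by have := i.val_lt; simp; omega, rfl⟩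
    · rintro ⟨i, hi, rfl⟩
      exact ⟨(i : ZMod p.length), by
        simp at hi; simp only [ZMod.val_cast_of_lt (show i < p.length by omega)]⟩
  · intro i j hij
    have hn := hG ⟨_, hij⟩
    obtain ⟨x, y, hxy, hset⟩ := Set.ncard_eq_two.1 hn
    have e1 := fadj i
    have e2 := fadj (i - 1)
    rw [sub_add_cancel] at e2
    have hne : p.getVert (i+1).val ≠ p.getVert (i-1).val := by
      intro h
      have h := finj h
      have h2 : (2 : ZMod p.length) = 0 := by linear_combination h
      have h2' : ((2 : ℕ) : ZMod p.length) = 0 := by exact_mod_cast h2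
      rw [ZMod.natCast_eq_zero_iff] at h2'
      have := Nat.le_of_dvd (by norm_num) h2'
      omega
    rw [← SimpleGraph.mem_neighborSet, hset] at e1
    replace e2 := e2.symm
    rw [← SimpleGraph.mem_neighborSet, hset] at e2
    rw [← SimpleGraph.mem_neighborSet, hset] at hij
    have : p.getVert j.val = p.getVert (i+1).val ∨ p.getVert j.val = p.getVert (i-1).val := by
      simp only [Set.mem_insert_iff, Set.mem_singleton_iff] at e1 e2 hij
      grind
    rcases this with h | h
    · left; exact finj h
    · right; rw [finj h]; ring

/-- The set surrounding an edge. -/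
def surr (A : V → V → Prop) (u v : V) : Set V := {w | w ≠ u ∧ w ≠ v ∧ (A u w ∨ A v w)}

lemma surr_card [Fintype V] {A : V → V → Prop} {T : V → V → V → Prop} (h : Surf A T) (u v : V)
    (huv : A u v) : (surr A u v).ncard + 2 + {w | A u w ∧ A v w}.ncard =
      {w | A u w}.ncard + {w | A v w}.ncard := by
  have hne := h.irr _ _ huv
  have e1 : {w | A u w} ∪ {w | A v w} = surr A u v ∪ {u, v} := by
    ext w
    simp only [surr, Set.mem_union, Set.mem_ofPred_eq, Set.mem_insert_iff, Set.mem_singleton_iff]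
    have := h.symm _ _ huv
    by_cases h1 : w = u
    · subst h1; simp [this]
    by_cases h2 : w = v
    · subst h2; simp [huv]
    simp [h1, h2]
  have e2 : Disjoint (surr A u v) {u, v} := by
    rw [Set.disjoint_left]
    rintro w ⟨p, q, -⟩ hw
    simp at hw; tauto
  have e3 := Set.ncard_union_eq e2
  rw [Set.ncard_pair hne, ← e1] at e3
  have := Set.ncard_union_add_ncard_inter {w | A u w} {w | A v w}
  rw [e3] at this
  exact this

/-- neighbours of the common edge -/
lemma isCycles_of [Fintype V] (G : SimpleGraph V)
    (h : ∀ x y, G.Adj x y → ∃ a b, a ≠ b ∧ ∀ c, G.Adj x c ↔ c = a ∨ c = b) : G.IsCycles := by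
  rintro x ⟨y, hy⟩
  obtain ⟨a, b, hab, hc⟩ := h x y hy
  rw [Set.ncard_eq_two]
  exact ⟨a, b, hab, by ext c; simp [hc]⟩

section
variable {A : V → V → Prop} {T : V → V → V → Prop}

/-- link graph -/
def Surf.link (h : Surf A T) (u : V) : SimpleGraph V where
  Adj p q := T u p q
  symm := ⟨fun _ _ e => h.t2 _ _ _ e⟩
  loopless := ⟨fun p e => h.irr _ _ (h.ta _ _ _ (h.t1 _ _ _ (h.t2 _ _ _ (h.t1 _ _ _ e)))) rfl⟩

/-- surrounding graph -/
def Surf.sgraph (h : Surf A T) (u v : V) : SimpleGraph V where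
  Adj p q := p ∈ surr A u v ∧ q ∈ surr A u v ∧ A p q
  symm := ⟨fun _ _ e => ⟨e.2.1, e.1, h.symm _ _ e.2.2⟩⟩
  loopless := ⟨fun _ e => h.irr _ _ e.2.2 rfl⟩

lemma Surf.half_conn [Fintype V] (h : Surf A T) (G : SimpleGraph V) {u v a b : V}
    (hab : a ≠ b) (hc : ∀ c, T u v c ↔ c = a ∨ c = b)
    (hG : ∀ p q, p ≠ v → q ≠ v → T u p q → G.Adj p q) :
    ∀ w, w ≠ v → A u w → G.Reachable w a := by
  have Ta := (hc a).2 (.inl rfl)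
  have Tb := (hc b).2 (.inr rfl)
  have hav : a ≠ v := fun e => (h.link u).loopless.irrefl v (by
    show T u v v
    exact e ▸ Ta)
  have hbv : b ≠ v := fun e => (h.link u).loopless.irrefl v (by
    show T u v v
    exact e ▸ Tb)
  have hcyc : (h.link u).IsCycles := isCycles_of _ (fun x y e => h.edge u x (h.ta _ _ _ e))
  have hdel := hcyc.reachable_deleteEdges (v := v) (w := a) Ta
  rw [SimpleGraph.reachable_iff_reflTransGen] at hdel
  have hba : G.Reachable b a := by
    have : (v ≠ v → G.Reachable v a) ∧ (v = v → G.Reachable b a) := by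
      refine Relation.ReflTransGen.head_induction_on
        (motive := fun w _ => (w ≠ v → G.Reachable w a) ∧ (w = v → G.Reachable b a)) hdel ?_ ?_
      · exact ⟨fun _ => .refl _, fun e => absurd e hav⟩
      · intro w w' hww _ ih
        rw [SimpleGraph.deleteEdges_adj] at hww
        obtain ⟨hT, hnot⟩ := hww
        have hT : T u w w' := hT
        constructor
        · intro hw
          by_cases hw' : w' = v
          · subst hw'
            rcases (hc w).1 (h.t2 _ _ _ hT) with e | e
            · subst e; simp at hnot
            · rw [e]; exact ih.2 rfl
          · exact (hG _ _ hw hw' hT).reachable.trans (ih.1 hw')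
        · intro hw
          subst hw
          rcases (hc w').1 hT with e | e
          · subst e; simp at hnot
          · subst e; exact ih.1 hbv
    exact this.2 rfl
  intro w hw hA
  have hch := h.conn u w a hA (h.ta _ _ _ (h.t2 _ _ _ Ta))
  revert hw
  refine Relation.ReflTransGen.head_induction_on
    (motive := fun w _ => w ≠ v → G.Reachable w a) hch ?_ ?_
  · intro _; exact .refl _
  · intro w w' hT _ ih hw
    by_cases hw' : w' = v
    · subst hw'
      rcases (hc w).1 (h.t2 _ _ _ hT) with e | e
      · subst e; exact .refl _
      · subst e; exact hba
    · exact (hG _ _ hw hw' hT).reachable.trans (ih hw')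

/-- relational version of the Pogorelov property -/
def Pog (A : V → V → Prop) (T : V → V → V → Prop) : Prop :=
  (∀ x y z, A x y → A y z → A x z → T x y z) ∧
  (∀ x y z w, A x y → A x z → A x w → A y z → A y w → A z w → False) ∧
  (∀ x y z w, A x y → A y z → A z w → A w x → x ≠ z → y ≠ w → A x z ∨ A y w)

lemma surf_forward [Fintype V] (h : Surf A T) (hP : Pog A T) (u v : V) (huv : A u v) :
    (surr A u v).ncard = {w | A u w}.ncard + {w | A v w}.ncard - 4 ∧ 3 ≤ (surr A u v).ncard ∧
    ∃ f : ZMod (surr A u v).ncard → V, Function.Injective f ∧ Set.range f = surr A u v ∧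
      (∀ i, A (f i) (f (i + 1))) ∧ (∀ i j, A (f i) (f j) → j = i + 1 ∨ i = j + 1) ∧
      (∀ i j l, ¬ T (f i) (f j) (f l)) := by
  obtain ⟨F3, F4, B4⟩ := hP
  have hs := h.symm
  have hirr := h.irr
  obtain ⟨a, b, hab, hc⟩ := h.edge u v huv
  have hvu := hs _ _ huv
  have hcap : ∀ c, A u c ∧ A v c ↔ c = a ∨ c = b := by
    intro c
    rw [← hc]
    constructor
    · rintro ⟨p, q⟩; exact F3 _ _ _ huv q p
    · intro t; exact ⟨h.ta _ _ _ (h.t2 _ _ _ t), h.ta _ _ _ (h.t2 _ _ _ (h.t1 _ _ _ t))⟩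
  have hcard := surr_card h u v huv
  have : {w | A u w ∧ A v w} = {a, b} := by ext c; simp [hcap]
  rw [this, Set.ncard_pair hab] at hcard
  refine ⟨by omega, ?_⟩
  have hua := (hcap a).2 (.inl rfl)
  have hub := (hcap b).2 (.inr rfl)
  have hnab : ¬ A a b := fun e => F4 u v a b huv hua.1 hub.1 hua.2 hub.2 e
  have TA : ∀ x y z, T x y z ↔ A x y ∧ A x z ∧ A y z := by
    intro x y z
    constructor
    · intro t
      exact ⟨h.ta _ _ _ t, h.ta _ _ _ (h.t2 _ _ _ t), h.ta _ _ _ (h.t2 _ _ _ (h.t1 _ _ _ t))⟩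
    · rintro ⟨p, q, r⟩; exact F3 _ _ _ p r q
  -- cross edges do not exist
  have cross : ∀ p ∈ surr A u v, ∀ q ∈ surr A u v, A p q → (A u p ∧ A u q) ∨ (A v p ∧ A v q) := by
    rintro p ⟨p1, p2, p3⟩ q ⟨q1, q2, q3⟩ hpq
    by_contra hcon
    rcases p3 with p3 | p3 <;> rcases q3 with q3 | q3
    · tauto
    · have := B4 u p q v p3 hpq (hs _ _ q3) hvu (Ne.symm q1) p2
      have := hs p v
      tauto
    · have := B4 v p q u p3 hpq (hs _ _ q3) huv (Ne.symm q2) p1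
      have := hs p u
      tauto
    · tauto
  -- two neighbours at a common vertex
  have corner : ∀ a b, a ≠ b → (∀ c, A u c ∧ A v c ↔ c = a ∨ c = b) → ¬ A a b →
      ∃ x y, x ≠ y ∧ ∀ c, (c ∈ surr A u v ∧ A a c) ↔ c = x ∨ c = y := by
    intro a b hab hcap hnab
    have hua := (hcap a).2 (.inl rfl)
    obtain ⟨p, p', hpp, hp⟩ := h.edge u a hua.1
    obtain ⟨q, q', hqq, hq⟩ := h.edge v a hua.2
    have hv := (hp v).1 ((TA _ _ _).2 ⟨hua.1, huv, hs _ _ hua.2⟩)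
    have hu := (hq u).1 ((TA _ _ _).2 ⟨hua.2, hvu, hs _ _ hua.1⟩)
    obtain ⟨x, hxv, hx⟩ : ∃ x, x ≠ v ∧ ∀ c, T u a c ↔ c = v ∨ c = x := by
      rcases hv with rfl | rfl
      · exact ⟨p', hpp.symm, hp⟩
      · exact ⟨p, hpp, fun c => by rw [hp, or_comm]⟩
    obtain ⟨y, hyu, hy⟩ : ∃ y, y ≠ u ∧ ∀ c, T v a c ↔ c = u ∨ c = y := by
      rcases hu with rfl | rfl
      · exact ⟨q', hqq.symm, hq⟩
      · exact ⟨q, hqq, fun c => by rw [hq, or_comm]⟩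
    have tx := (TA _ _ _).1 ((hx x).2 (.inr rfl))
    have ty := (TA _ _ _).1 ((hy y).2 (.inr rfl))
    have hau := hirr _ _ hua.1
    refine ⟨x, y, ?_, ?_⟩
    · rintro rfl
      rcases (hcap x).1 ⟨tx.2.1, ty.2.1⟩ with e | e
      · exact hirr _ _ tx.2.2 e.symm
      · exact hnab (e ▸ tx.2.2)
    · intro c
      constructor
      · rintro ⟨⟨c1, c2, c3⟩, hac⟩
        rcases c3 with c3 | c3
        · left
          have := (hx c).1 ((TA _ _ _).2 ⟨hua.1, c3, hac⟩)
          tauto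
        · right
          have := (hy c).1 ((TA _ _ _).2 ⟨hua.2, c3, hac⟩)
          tauto
      · rintro (rfl | rfl)
        · exact ⟨⟨(hirr _ _ tx.2.1).symm, hxv, .inl tx.2.1⟩, tx.2.2⟩
        · exact ⟨⟨hyu, (hirr _ _ ty.2.1).symm, .inr ty.2.1⟩, ty.2.2⟩
  have hG : (h.sgraph u v).IsCycles := by
    apply isCycles_of
    rintro x y ⟨hx, hy, hxy⟩
    suffices ∃ p q, p ≠ q ∧ ∀ c, (c ∈ surr A u v ∧ A x c) ↔ c = p ∨ c = q by
      obtain ⟨p, q, hpq, hh⟩ := this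
      refine ⟨p, q, hpq, fun c => ?_⟩
      rw [← hh]
      exact ⟨fun e => e.2, fun e => ⟨hx, e⟩⟩
    by_cases h1 : A u x <;> by_cases h2 : A v x
    · rcases (hcap x).1 ⟨h1, h2⟩ with rfl | rfl
      · exact corner _ b hab hcap hnab
      · exact corner _ a hab.symm (fun c => by rw [hcap, or_comm]) (fun e => hnab (hs _ _ e))
    · obtain ⟨p, q, hpq, hh⟩ := h.edge u x h1
      refine ⟨p, q, hpq, fun c => ?_⟩
      rw [← hh, TA]
      constructor
      · rintro ⟨hcS, hxc⟩
        have := cross x hx c hcS hxc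
        tauto
      · rintro ⟨-, huc, hxc⟩
        refine ⟨⟨(hirr _ _ huc).symm, ?_, .inl huc⟩, hxc⟩
        rintro rfl; exact h2 (hs _ _ hxc)
    · obtain ⟨p, q, hpq, hh⟩ := h.edge v x h2
      refine ⟨p, q, hpq, fun c => ?_⟩
      rw [← hh, TA]
      constructor
      · rintro ⟨hcS, hxc⟩
        have := cross x hx c hcS hxc
        tauto
      · rintro ⟨-, huc, hxc⟩
        refine ⟨⟨?_, (hirr _ _ huc).symm, .inr huc⟩, hxc⟩
        rintro rfl; exact h1 (hs _ _ hxc)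
    · rcases hx.2.2 with e | e <;> contradiction
  have haS : a ∈ surr A u v := ⟨(hirr _ _ hua.1).symm, (hirr _ _ hua.2).symm, .inl hua.1⟩
  have hnbr : ((h.sgraph u v).neighborSet a).Nonempty := by
    obtain ⟨x, y, -, hh⟩ := corner a b hab hcap hnab
    exact ⟨x, haS, (hh x).2 (.inl rfl)⟩
  have c1 := h.half_conn (h.sgraph u v) hab hc (by
    intro p q hp hq ht
    have ht := (TA _ _ _).1 ht
    exact ⟨⟨(hirr _ _ ht.1).symm, hp, .inl ht.1⟩, ⟨(hirr _ _ ht.2.1).symm, hq, .inl ht.2.1⟩, ht.2.2⟩)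
  have c2 := h.half_conn (u := v) (v := u) (h.sgraph u v) hab
    (fun c => by rw [← hc]; exact ⟨h.t1 _ _ _, h.t1 _ _ _⟩) (by
    intro p q hp hq ht
    have ht := (TA _ _ _).1 ht
    exact ⟨⟨hp, (hirr _ _ ht.1).symm, .inr ht.1⟩, ⟨hq, (hirr _ _ ht.2.1).symm, .inr ht.2.1⟩, ht.2.2⟩)
  obtain ⟨h3, f, finj, fr, fa, fc⟩ := exists_cycle_param (h.sgraph u v) hG (surr A u v) a haS hnbr
    (fun x y e => e.1) (by
      rintro x ⟨x1, x2, x3⟩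
      rcases x3 with x3 | x3
      · exact (c1 x x2 x3).symm
      · exact (c2 x x1 x3).symm)
  have fm : ∀ i, f i ∈ surr A u v := fun i => fr ▸ Set.mem_range_self i
  refine ⟨h3, f, finj, fr, fun i => (fa i).2.2, fun i j e => fc i j ⟨fm i, fm j, e⟩, ?_⟩
  intro i j l ht
  have ht := (TA _ _ _).1 ht
  have k1 := cross _ (fm i) _ (fm j) ht.1
  have k2 := cross _ (fm i) _ (fm l) ht.2.1
  have k3 := cross _ (fm j) _ (fm l) ht.2.2
  have z1 := F4 u (f i) (f j) (f l)
  have z2 := F4 v (f i) (f j) (f l)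
  tauto

lemma surf_backward [Fintype V] (h : Surf A T)
    (H : ∀ u v, A u v → 3 ≤ {w | A u w}.ncard + {w | A v w}.ncard - 4 ∧
      ∃ f : ZMod ({w | A u w}.ncard + {w | A v w}.ncard - 4) → V,
        Function.Injective f ∧ Set.range f = surr A u v ∧
        (∀ i j, A (f i) (f j) → j = i + 1 ∨ i = j + 1)) : Pog A T := by
  have hs := h.symm
  have hirr := h.irr
  have ta : ∀ x y z, T x y z → A x y ∧ A x z ∧ A y z := fun x y z t =>
      ⟨h.ta _ _ _ t, h.ta _ _ _ (h.t2 _ _ _ t), h.ta _ _ _ (h.t2 _ _ _ (h.t1 _ _ _ t))⟩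
  have F3 : ∀ x y z, A x y → A y z → A x z → T x y z := by
    intro x y z hxy hyz hxz
    obtain ⟨h3, f, finj, fr, -⟩ := H x y hxy
    have hcard := surr_card h x y hxy
    rw [← fr, ← Set.image_univ, Set.ncard_image_of_injective _ finj, Set.ncard_univ,
      Nat.card_zmod] at hcard
    obtain ⟨a, b, hab, hc⟩ := h.edge x y hxy
    have hsub : ({a, b} : Set V) ⊆ {w | A x w ∧ A y w} := by
      intro c hcc
      have := ta _ _ _ ((hc c).2 hcc)
      exact this.2
    have heq := Set.eq_of_subset_of_ncard_le hsub (by rw [Set.ncard_pair hab]; omega)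
    have : z ∈ ({a, b} : Set V) := by rw [heq]; exact ⟨hxz, hyz⟩
    exact (hc z).2 this
  have deg3 : ∀ x y z w, A x y → A x z → A x w → A y z → A y w → A z w →
      {c | A x c}.ncard ≤ 3 := by
    intro x y z w hxy hxz hxw hyz hyw hzw
    have step : ∀ y z w, A x y → A x z → A x w → A y z → A y w → A z w → ∀ c, T x y c →
        c = z ∨ c = w := by
      intro y z w hxy hxz hxw hyz hyw hzw c hT
      obtain ⟨a, b, hab, hc⟩ := h.edge x y hxy
      have e1 := (hc z).1 (F3 _ _ _ hxy hyz hxz)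
      have e2 := (hc w).1 (F3 _ _ _ hxy hyw hxw)
      have e3 := (hc c).1 hT
      have := hirr _ _ hzw
      grind
    have s1 := step y z w hxy hxz hxw hyz hyw hzw
    have s2 := step z y w hxz hxy hxw (hs _ _ hyz) hzw hyw
    have s3 := step w y z hxw hxy hxz (hs _ _ hyw) (hs _ _ hzw) hyz
    have : {c | A x c} ⊆ {y, z, w} := by
      intro c hcx
      have hch := h.conn x y c hxy hcx
      clear hcx
      induction hch with
      | refl => simp
      | tail _ hT ih =>
        simp only [Set.mem_insert_iff, Set.mem_singleton_iff] at ih ⊢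
        rcases ih with rfl | rfl | rfl
        · have := s1 _ hT; tauto
        · have := s2 _ hT; tauto
        · have := s3 _ hT; tauto
    refine (Set.ncard_le_ncard this).trans ?_
    refine (Set.ncard_insert_le _ _).trans ?_
    have := Set.ncard_insert_le z {w}
    rw [Set.ncard_singleton] at this
    omega
  refine ⟨F3, ?_, ?_⟩
  · intro x y z w hxy hxz hxw hyz hyw hzw
    have d1 := deg3 x y z w hxy hxz hxw hyz hyw hzw
    have d2 := deg3 y x z w (hs _ _ hxy) hyz hyw hxz hxw hzw
    have := (H x y hxy).1
    omega
  · intro x y z w hxy hyz hzw hwx hxz hyw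
    by_contra hcon
    push Not at hcon
    obtain ⟨h3, f, finj, fr, fc⟩ := H x y hxy
    obtain ⟨p, q, hpq, hh⟩ := h.edge y z hyz
    have tp := ta _ _ _ ((hh p).2 (.inl rfl))
    have tq := ta _ _ _ ((hh q).2 (.inr rfl))
    have hzS : z ∈ surr A x y := ⟨hxz.symm, (hirr _ _ hyz).symm, .inr hyz⟩
    have hwS : w ∈ surr A x y := ⟨hirr _ _ hwx, hyw.symm, .inl (hs _ _ hwx)⟩
    have hpS : p ∈ surr A x y := ⟨by rintro rfl; exact hcon.1 (hs _ _ tp.2.2),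
      (hirr _ _ tp.2.1).symm, .inr tp.2.1⟩
    have hqS : q ∈ surr A x y := ⟨by rintro rfl; exact hcon.1 (hs _ _ tq.2.2),
      (hirr _ _ tq.2.1).symm, .inr tq.2.1⟩
    rw [← fr] at hzS hwS hpS hqS
    obtain ⟨i, rfl⟩ := hzS
    obtain ⟨j, rfl⟩ := hwS
    obtain ⟨k, rfl⟩ := hpS
    obtain ⟨l, rfl⟩ := hqS
    have e1 := fc _ _ hzw
    have e2 := fc _ _ tp.2.2
    have e3 := fc _ _ tq.2.2
    have n1 : j ≠ k := by rintro rfl; exact hcon.2 tp.2.1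
    have n2 : j ≠ l := by rintro rfl; exact hcon.2 tq.2.1
    have n3 : k ≠ l := by rintro rfl; exact hpq rfl
    have sub : ∀ j, (j = i + 1 ∨ i = j + 1) → (j = i + 1 ∨ j = i - 1) := by
      rintro j (e | e)
      · exact .inl e
      · right; rw [e]; ring
    rcases sub _ e1 with e1 | e1 <;> rcases sub _ e2 with e2 | e2 <;>
      rcases sub _ e3 with e3 | e3 <;> simp_all

end

lemma pog_iff [DecidableEq V] [Fintype V] (K : SC V) (hS : IsSphere2 K) :
    IsPogorelov K ↔ Pog K.A K.T := by
  have h := surf_of_sphere K hS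
  obtain ⟨h1, h2, -⟩ := hS
  constructor
  · rintro ⟨hf, hb⟩
    refine ⟨?_, ?_, ?_⟩
    · intro x y z hxy hyz hxz
      refine ⟨hxy.1, hxz.1, hyz.1, hf _ (by simp) (fun u _ => h1 u) ?_⟩
      have a1 := h.symm _ _ hxy
      have a2 := h.symm _ _ hxz
      have a3 := h.symm _ _ hyz
      have := hxy.2; have := hxz.2; have := hyz.2
      have := a1.2; have := a2.2; have := a3.2
      intro u hu w hw huw
      simp only [Finset.mem_insert, Finset.mem_singleton] at hu hw
      rcases hu with rfl | rfl | rfl <;> rcases hw with rfl | rfl | rfl <;>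
        first | assumption | exact absurd rfl huw
    · intro x y z w hxy hxz hxw hyz hyw hzw
      have hmem : ({x, y, z, w} : Finset V) ∈ K.faces := by
        refine hf _ (by simp) (fun u _ => h1 u) ?_
        have := (h.symm _ _ hxy).2; have := (h.symm _ _ hxz).2; have := (h.symm _ _ hxw).2
        have := (h.symm _ _ hyz).2; have := (h.symm _ _ hyw).2; have := (h.symm _ _ hzw).2
        have := hxy.2; have := hxz.2; have := hxw.2
        have := hyz.2; have := hyw.2; have := hzw.2
        intro u hu w hw huw
        simp only [Finset.mem_insert, Finset.mem_singleton] at hu hw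
        rcases hu with rfl | rfl | rfl | rfl <;> rcases hw with rfl | rfl | rfl | rfl <;>
          first | assumption | exact absurd rfl huw
      have := h2 _ hmem
      rw [Finset.card_insert_of_notMem (by simp [hxy.1, hxz.1, hxw.1]),
        Finset.card_insert_of_notMem (by simp [hyz.1, hyw.1]), Finset.card_pair hzw.1] at this
      omega
    · intro x y z w hxy hyz hzw hwx hxz hyw
      by_contra hcon
      push Not at hcon
      apply hb
      have n1 : ({x, z} : Finset V) ∉ K.faces := fun e => hcon.1 ⟨hxz, e⟩
      have n2 : ({y, w} : Finset V) ∉ K.faces := fun e => hcon.2 ⟨hyw, e⟩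
      have n1' : ({z, x} : Finset V) ∉ K.faces := by rwa [Finset.pair_comm]
      have n2' : ({w, y} : Finset V) ∉ K.faces := by rwa [Finset.pair_comm]
      let f : ZMod 4 → V := (![x, y, z, w] : Fin 4 → V)
      have f0 : f 0 = x := rfl
      have f1 : f 1 = y := rfl
      have f2 : f 2 = z := rfl
      have f3 : f 3 = w := rfl
      have all4 : ∀ i : ZMod 4, i = 0 ∨ i = 1 ∨ i = 2 ∨ i = 3 := by decide
      have opp : ∀ i j : ZMod 4, j = i + 2 → ({f i, f j} : Finset V) ∉ K.faces := by
        rintro i _ rfl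
        rcases all4 i with rfl | rfl | rfl | rfl
        · exact n1
        · exact n2
        · exact n1'
        · exact n2'
      refine ⟨f, by norm_num, ?_, ?_, ?_, ?_⟩
      · intro i j hij
        have := hxy.1; have := hyz.1; have := hzw.1; have := hwx.1
        rcases all4 i with rfl | rfl | rfl | rfl <;> rcases all4 j with rfl | rfl | rfl | rfl <;>
          first | rfl | (exfalso; simp only [f0, f1, f2, f3] at hij; first | exact this hij.symm | (subst hij; contradiction) | (simp_all))
      · intro i
        rcases all4 i with rfl | rfl | rfl | rfl
        · exact hxy.2
        · exact hyz.2
        · exact hzw.2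
        · exact hwx.2
      · intro i j hij hm
        have hd : ∀ i j : ZMod 4, i ≠ j → (j = i + 1 ∨ i = j + 1) ∨ j = i + 2 := by decide
        rcases hd i j hij with e | e
        · exact e
        · exact absurd hm (opp i j e)
      · intro i j l hij hjl hil hm
        have hd : ∀ i j l : ZMod 4, i ≠ j → j ≠ l → i ≠ l →
          j = i + 2 ∨ l = i + 2 ∨ l = j + 2 := by decide
        rcases hd i j l hij hjl hil with e | e | e
        · exact opp i j e (K.down_closed _ hm _ (by intro w; simp; tauto))
        · exact opp i l e (K.down_closed _ hm _ (by intro w; simp; tauto))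
        · exact opp j l e (K.down_closed _ hm _ (by intro w; simp; tauto))
  · rintro ⟨F3, F4, B4⟩
    refine ⟨?_, ?_⟩
    · intro s hne hv hp
      have hA : ∀ u ∈ s, ∀ w ∈ s, u ≠ w → K.A u w := fun u hu w hw e => ⟨e, hp u hu w hw e⟩
      have hcard : s.card < 4 := by
        by_contra hlt
        obtain ⟨t, hts, htc⟩ := Finset.exists_subset_card_eq (show 4 ≤ s.card by omega)
        obtain ⟨x, y, z, w, a1, a2, a3, a4, a5, a6, rfl⟩ := Finset.card_eq_four.1 htc
        have hx := hts (show x ∈ _ by simp)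
        have hy := hts (show y ∈ _ by simp)
        have hz := hts (show z ∈ _ by simp)
        have hw := hts (show w ∈ _ by simp)
        exact F4 x y z w (hA x hx y hy a1) (hA x hx z hz a2) (hA x hx w hw a3) (hA y hy z hz a4)
          (hA y hy w hw a5) (hA z hz w hw a6)
      have hpos := hne.card_pos
      obtain e | e | e : s.card = 1 ∨ s.card = 2 ∨ s.card = 3 := by omega
      · obtain ⟨x, rfl⟩ := Finset.card_eq_one.1 e
        exact h1 x
      · obtain ⟨x, y, hxy, rfl⟩ := Finset.card_eq_two.1 e
        exact hp x (by simp) y (by simp) hxy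
      · obtain ⟨x, y, z, hxy, hxz, hyz, rfl⟩ := Finset.card_eq_three.1 e
        exact (F3 x y z (hA x (by simp) y (by simp) hxy) (hA y (by simp) z (by simp) hyz)
          (hA x (by simp) z (by simp) hxz)).2.2.2
    · rintro ⟨f, -, finj, fa, fc, -⟩
      have hA : ∀ i, K.A (f i) (f (i + 1)) := fun i =>
        ⟨fun e => absurd (finj e) ((by decide : ∀ i : ZMod 4, ¬ i = i + 1) i), fa i⟩
      have hn : ∀ i, ¬ K.A (f i) (f (i + 2)) := fun i e => by
        have := fc i (i + 2) ((by decide : ∀ i : ZMod 4, i ≠ i + 2) i) e.2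
        revert this
        clear e
        revert i; decide
      rcases B4 (f 0) (f 1) (f 2) (f 3) (hA 0) (hA 1) (hA 2) (hA 3)
        (fun e => absurd (finj e) (by decide)) (fun e => absurd (finj e) (by decide)) with e | e
      · exact hn 0 e
      · exact hn 1 e

lemma vdeg_eq [DecidableEq V] (K : SC V) (v : V) : K.vdeg v = {w | K.A v w}.ncard := by
  unfold SC.vdeg SC.A
  congr 1
  ext w
  simp [ne_comm]

lemma surr_eq [DecidableEq V] (K : SC V) (u v : V) : {w | w ≠ u ∧ w ≠ v ∧
    (({w, u} : Finset V) ∈ K.faces ∨ ({w, v} : Finset V) ∈ K.faces)} = surr K.A u v := by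
  ext w
  simp only [surr, SC.A, Set.mem_ofPred_eq, Finset.pair_comm w]
  constructor
  · rintro ⟨a, b, c⟩
    exact ⟨a, b, c.imp (fun h => ⟨a.symm, h⟩) (fun h => ⟨b.symm, h⟩)⟩
  · rintro ⟨a, b, c⟩
    exact ⟨a, b, c.imp And.right And.right⟩

/-- A simple 3-polytope `P` other than the simplex (encoded by its dual simplicial
2-sphere `K`) is Pogorelov if and only if each pair of adjacent facets is surrounded
by a belt, necessarily of length `k₁ + k₂ - 4` where the facets have `k₁` and `k₂`
edges; the belt consists exactly of the facets adjacent to the pair. -/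
theorem stmt7 {V : Type} [DecidableEq V] [Fintype V] (K : SC V) (hS : IsSphere2 K)
    (hne : ¬ IsSimplexBoundary K) :
    IsPogorelov K ↔ ∀ u v : V, u ≠ v → ({u, v} : Finset V) ∈ K.faces →
      ∃ f : ZMod (K.vdeg u + K.vdeg v - 4) → V,
        IsBelt K (K.vdeg u + K.vdeg v - 4) f ∧
        Set.range f = {w | w ≠ u ∧ w ≠ v ∧
          (({w, u} : Finset V) ∈ K.faces ∨ ({w, v} : Finset V) ∈ K.faces)} := by
  have h := surf_of_sphere K hS
  rw [pog_iff K hS]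
  constructor
  · intro hP u v huv he
    obtain ⟨hk, h3, f, finj, fr, fa, fc, ft⟩ := surf_forward h hP u v ⟨huv, he⟩
    rw [surr_eq, vdeg_eq, vdeg_eq, ← hk]
    refine ⟨f, ⟨h3, finj, fun i => (fa i).2, ?_, ?_⟩, fr⟩
    · intro i j hij hm
      exact fc i j ⟨fun e => hij (finj e), hm⟩
    · intro i j l hij hjl hil hm
      exact ft i j l ⟨fun e => hij (finj e), fun e => hil (finj e), fun e => hjl (finj e), hm⟩
  · intro H
    apply surf_backward h
    rintro u v ⟨huv, he⟩
    have := H u v huv he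
    rw [surr_eq, vdeg_eq, vdeg_eq] at this
    obtain ⟨f, ⟨h3, finj, fa, fc, ft⟩, fr⟩ := this
    exact ⟨h3, f, finj, fr, fun i j e => fc i j (fun e' => e.1 (by rw [e'])) e.2⟩
end

section
/- For any Pogorelov polytope P, there exists a nontrivial triple Massey product ⟨α, β, γ⟩ ⊆ H^{n+4}(Z_P) for some n ≥ 5, with α ∈ H⁴(Z_P), β ∈ H^{n−2}(Z_P), γ ∈ H³(Z_P). In particular, the moment-angle manifold Z_P is not formal. -/
variable {V : Type}
/-- The sign `(-1)^{number of elements of J smaller than j}`. -/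
def eps [LinearOrder V] (J : Finset V) (j : V) : ℤ :=
  (-1) ^ (J.filter (fun a => a < j)).card
section RAlgebra
variable [LinearOrder V]
attribute [local instance] Classical.propDecidable

/-- The pair `(J, I)` indexes an admissible monomial `u_J v_I` of
`R*(K) = Λ[u_1,…,u_m] ⊗ ℤ[K]/(v_i² = u_i v_i = 0)`. -/
def SC.admissible (K : SC V) (p : Finset V × Finset V) : Prop :=
  Disjoint p.1 p.2 ∧ p.2 ∈ K.faces

/-- The underlying abelian group of the algebra
`R*(K) = Λ[u_1,…,u_m] ⊗ ℤ[K]/(v_i² = u_i v_i = 0)`: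
the free abelian group on the monomials `u_J v_I`, `I ∈ K`, `I ∩ J = ∅`.
It is a cochain model of the moment-angle complex `Z_K`. -/
abbrev RK (K : SC V) : Type := {p : Finset V × Finset V // K.admissible p} →₀ ℤ

/-- The monomial `u_{p.1} v_{p.2}` of `R*(K)` (equal to `0` if `p` is not admissible,
which encodes the relations `v_i² = u_i v_i = 0` and the Stanley–Reisner relations). -/
noncomputable def RK.mk (K : SC V) (p : Finset V × Finset V) : RK K :=
  if h : K.admissible p then Finsupp.single ⟨p, h⟩ 1 else 0

/-- The differential on a monomial: `d(u_J v_I) = Σ_{j∈J} ± u_{J∖j} v_{I∪j}`. -/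
noncomputable def dB (K : SC V) (p : Finset V × Finset V) : RK K :=
  ∑ j ∈ p.1, eps p.1 j • RK.mk K (p.1.erase j, insert j p.2)

/-- The differential of `R*(K)` (sending `u_i ↦ v_i`, `v_i ↦ 0`). -/
noncomputable def dR (K : SC V) (x : RK K) : RK K :=
  x.sum fun p c => c • dB K p.val

/-- The Koszul sign of the shuffle merging `u_J` and `u_{J'}`. -/
noncomputable def shuffleSign (J J' : Finset V) : ℤ :=
  (-1) ^ (∑ a ∈ J, (J'.filter (fun b => b < a)).card)

/-- Product of monomials of `R*(K)`. -/
noncomputable def mulB (K : SC V) (p q : Finset V × Finset V) : RK K :=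
  if Disjoint (p.1 ∪ p.2) (q.1 ∪ q.2) then
    shuffleSign p.1 q.1 • RK.mk K (p.1 ∪ q.1, p.2 ∪ q.2)
  else 0

/-- The product of the algebra `R*(K)`. -/
noncomputable def mulR (K : SC V) (x y : RK K) : RK K :=
  x.sum fun p c => y.sum fun q c' => (c * c') • mulB K p.val q.val

/-- `x` is homogeneous of total (cellular) degree `k`: `deg u_i = 1`, `deg v_i = 2`;
so `x` represents a class of `H^k(Z_K)`. -/
def homogTotal (K : SC V) (x : RK K) (k : ℕ) : Prop :=
  ∀ p ∈ x.support, p.val.1.card + 2 * p.val.2.card = k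

/-- `x` is supported in multidegree `2S`, i.e. in the Hochster summand of the
full subcomplex `K_S`. -/
def homogM (K : SC V) (x : RK K) (S : Finset V) : Prop :=
  ∀ p ∈ x.support, p.val.1 ∪ p.val.2 = S

/-- `x` and `y` are cohomologous cocycles (differ by a coboundary). -/
def Cohomologous (K : SC V) (x y : RK K) : Prop := ∃ t : RK K, x = y + dR K t

/-- The set of all cocycle-level values of the triple Massey product
`⟨[a], [b], [c]⟩` (with `k₁ = deg a`), saturated under coboundaries: all choices of
representing cocycles and of primitives `w₁, w₂` with `d w₁ = a'b'`, `d w₂ = b'c'`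
give `±a'w₂ + w₁c'` up to a coboundary.  A cohomology class belongs to the Massey
product iff one (hence any) of its representing cocycles lies in this set. -/
def MasseySet (K : SC V) (k₁ : ℕ) (a b c : RK K) : Set (RK K) :=
  {z | ∃ a' b' c' w₁ w₂ t : RK K,
    dR K a' = 0 ∧ dR K b' = 0 ∧ dR K c' = 0 ∧
    Cohomologous K a' a ∧ Cohomologous K b' b ∧ Cohomologous K c' c ∧
    dR K w₁ = mulR K a' b' ∧ dR K w₂ = mulR K b' c' ∧
    z = ((-1 : ℤ) ^ (k₁ + 1)) • mulR K a' w₂ + mulR K w₁ c' + dR K t}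

end RAlgebra


section Algebra2
attribute [local instance] Classical.propDecidable

/-- The mod 2 reduction of `R*(K)`. -/
abbrev F2 (K : SC V) : Type := {p : Finset V × Finset V // K.admissible p} →₀ ZMod 2

noncomputable def mk2 (K : SC V) (p : Finset V × Finset V) : F2 K :=
  if h : K.admissible p then Finsupp.single ⟨p, h⟩ 1 else 0

noncomputable def dB2 (K : SC V) (p : Finset V × Finset V) : F2 K :=
  ∑ j ∈ p.1, mk2 K (p.1.erase j, insert j p.2)

noncomputable def mulB2 (K : SC V) (p q : Finset V × Finset V) : F2 K :=
  if Disjoint (p.1 ∪ p.2) (q.1 ∪ q.2) then mk2 K (p.1 ∪ q.1, p.2 ∪ q.2) else 0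

noncomputable def D2 (K : SC V) : F2 K →ₗ[ZMod 2] F2 K :=
  Finsupp.linearCombination (ZMod 2) (fun p => dB2 K p.val)

noncomputable def M2 (K : SC V) : F2 K →ₗ[ZMod 2] F2 K →ₗ[ZMod 2] F2 K :=
  Finsupp.linearCombination (ZMod 2)
    (fun p => Finsupp.linearCombination (ZMod 2) (fun q => mulB2 K p.val q.val))

lemma mk2_of (K : SC V) {p : Finset V × Finset V} (h : K.admissible p) :
    mk2 K p = Finsupp.single ⟨p, h⟩ 1 := dif_pos h

lemma mk2_not (K : SC V) {p : Finset V × Finset V} (h : ¬ K.admissible p) :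
    mk2 K p = 0 := dif_neg h

lemma D2_mk2 (K : SC V) (p : Finset V × Finset V) (hp : Disjoint p.1 p.2) :
    D2 K (mk2 K p) = dB2 K p := by
  by_cases h : K.admissible p
  · rw [mk2_of K h, D2, Finsupp.linearCombination_single, one_smul]
  · rw [mk2_not K h, map_zero]
    symm
    refine Finset.sum_eq_zero fun j _ => mk2_not K fun h' => h ⟨hp, ?_⟩
    exact K.down_closed _ h'.2 _ (Finset.subset_insert _ _)

lemma M2_mk2 (K : SC V) (p q : Finset V × Finset V) :
    M2 K (mk2 K p) (mk2 K q) = mulB2 K p q := by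
  by_cases hp : K.admissible p
  · by_cases hq : K.admissible q
    · rw [mk2_of K hp, mk2_of K hq, M2, Finsupp.linearCombination_single, one_smul,
        Finsupp.linearCombination_single, one_smul]
    · rw [mk2_not K hq, map_zero, mulB2]
      split_ifs with hd
      · refine (mk2_not K fun h' => hq ⟨?_, ?_⟩).symm
        · exact h'.1.mono Finset.subset_union_right Finset.subset_union_right
        · exact K.down_closed _ h'.2 _ Finset.subset_union_right
      · rfl
  · rw [mk2_not K hp, map_zero, LinearMap.zero_apply, mulB2]
    split_ifs with hd
    · refine (mk2_not K fun h' => hp ⟨?_, ?_⟩).symm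
      · exact h'.1.mono Finset.subset_union_left Finset.subset_union_left
      · exact K.down_closed _ h'.2 _ Finset.subset_union_left
    · rfl

lemma single_eq (K : SC V) (p : {p : Finset V × Finset V // K.admissible p}) (c : ZMod 2) :
    (Finsupp.single p c : F2 K) = c • mk2 K p.val := by
  rw [mk2_of K p.2, Finsupp.smul_single, smul_eq_mul, mul_one]

/-- Induction principle: linear statements need only be checked on monomials. -/
lemma F2_induction (K : SC V) {P : F2 K → Prop} (h0 : P 0)
    (ha : ∀ x y, P x → P y → P (x + y))
    (hm : ∀ p, K.admissible p → P (mk2 K p)) (x : F2 K) : P x := by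
  induction x using Finsupp.induction_linear with
  | zero => exact h0
  | add f g hf hg => exact ha _ _ hf hg
  | single p c =>
    rw [single_eq]
    have : c = 0 ∨ c = 1 := by revert c; decide
    rcases this with rfl | rfl
    · rw [zero_smul]; exact h0
    · rw [one_smul]; exact hm _ p.2

lemma M2_comm (K : SC V) (x y : F2 K) : M2 K x y = M2 K y x := by
  induction x using F2_induction with
  | h0 => simp
  | ha x y hx hy => rw [map_add, map_add, LinearMap.add_apply, hx, hy]
  | hm p hp =>
    induction y using F2_induction with
    | h0 => simp
    | ha x y hx hy => rw [map_add, map_add, LinearMap.add_apply, hx, hy]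
    | hm q hq =>
      rw [M2_mk2, M2_mk2, mulB2, mulB2, Finset.union_comm p.1 q.1, Finset.union_comm p.2 q.2]
      simp only [disjoint_comm]

lemma M2_assoc (K : SC V) (x y z : F2 K) :
    M2 K (M2 K x y) z = M2 K x (M2 K y z) := by
  induction x using F2_induction with
  | h0 => simp
  | ha x y hx hy => simp only [map_add, LinearMap.add_apply, hx, hy]
  | hm p hp =>
    induction y using F2_induction with
    | h0 => simp
    | ha x y hx hy => simp only [map_add, LinearMap.add_apply, hx, hy]
    | hm q hq =>
      induction z using F2_induction with
      | h0 => simp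
      | ha x y hx hy => simp only [map_add, hx, hy]
      | hm r hr =>
        rw [M2_mk2, M2_mk2, mulB2, mulB2]
        have hP : ∀ (A B C D E F : Finset V), Disjoint ((A ∪ B) ∪ (C ∪ D)) (E ∪ F) ↔
            Disjoint (A ∪ C) (E ∪ F) ∧ Disjoint (B ∪ D) (E ∪ F) := by
          intro A B C D E F
          simp only [Finset.disjoint_union_left, Finset.disjoint_union_right]
          tauto
        by_cases h1 : Disjoint (p.1 ∪ p.2) (q.1 ∪ q.2)
        · rw [if_pos h1, M2_mk2, mulB2]
          by_cases h2 : Disjoint (q.1 ∪ q.2) (r.1 ∪ r.2)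
          · rw [if_pos h2, M2_mk2, mulB2]
            by_cases h3 : Disjoint (p.1 ∪ p.2) (r.1 ∪ r.2)
            · rw [if_pos ((hP _ _ _ _ _ _).2 ⟨h3, h2⟩),
                if_pos ((hP _ _ _ _ _ _).2 ⟨h1.symm, h3.symm⟩ |>.symm)]
              simp only [Finset.union_assoc]
            · rw [if_neg fun h => h3 ((hP _ _ _ _ _ _).1 h).1,
                if_neg fun h => h3 ((hP _ _ _ _ _ _).1 h.symm).2.symm]
          · rw [if_neg h2, map_zero, if_neg fun h => h2 ((hP _ _ _ _ _ _).1 h).2]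
        · rw [if_neg h1, map_zero, LinearMap.zero_apply]
          by_cases h2 : Disjoint (q.1 ∪ q.2) (r.1 ∪ r.2)
          · rw [if_pos h2, M2_mk2, mulB2,
              if_neg fun h => h1 ((hP _ _ _ _ _ _).1 h.symm).1.symm]
          · rw [if_neg h2, map_zero]

lemma M2_leibniz (K : SC V) (x y : F2 K) :
    D2 K (M2 K x y) = M2 K (D2 K x) y + M2 K x (D2 K y) := by
  induction x using F2_induction with
  | h0 => simp
  | ha x y hx hy => simp only [map_add, LinearMap.add_apply, hx, hy]; abel
  | hm p hp =>
    induction y using F2_induction with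
    | h0 => simp
    | ha x y hx hy => simp only [map_add, hx, hy]; abel
    | hm q hq =>
      rw [M2_mk2, D2_mk2 K p hp.1, D2_mk2 K q hq.1, dB2, dB2, map_sum, map_sum,
        LinearMap.sum_apply]
      simp only [M2_mk2]
      have e1 : ∀ j ∈ p.1, (p.1.erase j ∪ insert j p.2) = p.1 ∪ p.2 := by
        intro j hj; ext t; by_cases ht : t = j <;> simp [ht, hj]
      have e2 : ∀ j ∈ q.1, (q.1.erase j ∪ insert j q.2) = q.1 ∪ q.2 := by
        intro j hj; ext t; by_cases ht : t = j <;> simp [ht, hj]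
      have e3 : ∀ j ∈ p.1, mulB2 K (p.1.erase j, insert j p.2) q =
          if Disjoint (p.1 ∪ p.2) (q.1 ∪ q.2) then
            mk2 K (p.1.erase j ∪ q.1, insert j p.2 ∪ q.2) else 0 := by
        intro j hj; simp only [mulB2]; rw [e1 j hj]
      have e4 : ∀ j ∈ q.1, mulB2 K p (q.1.erase j, insert j q.2) =
          if Disjoint (p.1 ∪ p.2) (q.1 ∪ q.2) then
            mk2 K (p.1 ∪ q.1.erase j, p.2 ∪ insert j q.2) else 0 := by
        intro j hj; simp only [mulB2]; rw [e2 j hj]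
      rw [Finset.sum_congr rfl e3, Finset.sum_congr rfl e4, mulB2]
      split_ifs with hd
      · have hd' := hd
        simp only [Finset.disjoint_union_left, Finset.disjoint_union_right] at hd'
        obtain ⟨⟨h11, h21⟩, h12, h22⟩ := hd'
        rw [D2_mk2, dB2]
        · simp only
          rw [Finset.sum_union h11]
          congr 1
          · refine Finset.sum_congr rfl fun j hj => ?_
            have : j ∉ q.1 := Finset.disjoint_left.1 h11 hj
            rw [Finset.erase_union_distrib, Finset.erase_eq_of_notMem this,
              Finset.insert_union]
          · refine Finset.sum_congr rfl fun j hj => ?_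
            have : j ∉ p.1 := Finset.disjoint_right.1 h11 hj
            rw [Finset.erase_union_distrib, Finset.erase_eq_of_notMem this,
              Finset.union_insert]
        · simp only [Finset.disjoint_union_left, Finset.disjoint_union_right]
          exact ⟨⟨hp.1, h21.symm⟩, h12, hq.1⟩
      · simp

lemma F2_two (K : SC V) (x : F2 K) : x + x = 0 := by
  rw [← two_smul (ZMod 2), show (2 : ZMod 2) = 0 from rfl, zero_smul]

/-- The Massey product does not change (mod coboundaries) under change of representatives. -/
lemma massey_change (K : SC V) (a b c t r s w₁ w₂ a' b' c' : F2 K)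
    (hb : D2 K b = 0) (ha : D2 K a = 0)
    (hc : D2 K c = 0)
    (ha' : a' = a + D2 K t) (hb' : b' = b + D2 K r) (hc' : c' = c + D2 K s)
    (hda' : D2 K a' = 0) (hdb' : D2 K b' = 0) (hdc' : D2 K c' = 0)
    (h1 : D2 K w₁ = M2 K a' b') (h2 : D2 K w₂ = M2 K b' c') :
    ∃ W₁ W₂ T : F2 K, D2 K W₁ = M2 K a b ∧ D2 K W₂ = M2 K b c ∧
      M2 K a' w₂ + M2 K w₁ c' = M2 K a W₂ + M2 K W₁ c + D2 K T := by
  have neg : ∀ x : F2 K, -x = x := fun x => (eq_neg_of_add_eq_zero_left (F2_two K x)).symm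
  have dda : D2 K (D2 K t) = 0 := by rw [ha', map_add, ha, zero_add] at hda'; exact hda'
  have ddb : D2 K (D2 K r) = 0 := by rw [hb', map_add, hb, zero_add] at hdb'; exact hdb'
  have ddc : D2 K (D2 K s) = 0 := by rw [hc', map_add, hc, zero_add] at hdc'; exact hdc'
  have f1 : D2 K (w₁ + M2 K t b' + M2 K a r) = M2 K a b := by
    rw [map_add, map_add, h1, M2_leibniz, M2_leibniz, hdb', ha, ha', hb']
    simp only [map_add, LinearMap.add_apply, map_zero, LinearMap.zero_apply]
    rw [← sub_eq_zero]
    simp only [sub_eq_add_neg, neg]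
    generalize M2 K a (D2 K r) = x1
    generalize M2 K (D2 K t) b = x2
    generalize M2 K (D2 K t) (D2 K r) = x3
    generalize M2 K a b = x4
    refine Eq.trans ?_ (F2_two K (x1 + x2 + x3 + x4))
    abel
  have f2 : D2 K (w₂ + M2 K r c' + M2 K b s) = M2 K b c := by
    rw [map_add, map_add, h2, M2_leibniz, M2_leibniz, hdc', hb, hb', hc']
    simp only [map_add, LinearMap.add_apply, map_zero, LinearMap.zero_apply]
    rw [← sub_eq_zero]
    simp only [sub_eq_add_neg, neg]
    generalize M2 K b (D2 K s) = x1
    generalize M2 K (D2 K r) c = x2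
    generalize M2 K (D2 K r) (D2 K s) = x3
    generalize M2 K b c = x4
    refine Eq.trans ?_ (F2_two K (x1 + x2 + x3 + x4))
    abel
  refine ⟨_, _, M2 K t (w₂ + M2 K r c' + M2 K b s) + M2 K (w₁ + M2 K t b' + M2 K a r) s
    + M2 K (M2 K t r) c' + M2 K (M2 K t b) s, f1, f2, ?_⟩
  have g1 := M2_leibniz K t (w₂ + M2 K r c' + M2 K b s)
  rw [f2] at g1
  have g2 := M2_leibniz K (w₁ + M2 K t b' + M2 K a r) s
  rw [f1] at g2
  have g3 : D2 K (M2 K (M2 K t r) c') = M2 K (M2 K (D2 K t) r + M2 K t (D2 K r)) c' := by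
    rw [M2_leibniz, hdc', map_zero, add_zero, M2_leibniz K t r]
  have g4 : D2 K (M2 K (M2 K t b) s) = M2 K (M2 K (D2 K t) b) s + M2 K (M2 K t b) (D2 K s) := by
    rw [M2_leibniz, M2_leibniz K t b, hb, map_zero, add_zero]
  rw [map_add (D2 K), map_add (D2 K), map_add (D2 K), g1, g2, g3, g4]
  clear g1 g2 g3 g4 f1 f2
  subst ha' hb' hc'
  simp only [map_add, LinearMap.add_apply, M2_assoc]
  rw [← sub_eq_zero]
  simp only [sub_eq_add_neg, neg]
  abel_nf
  have two' : ∀ x : F2 K, (2 : ℤ) • x = 0 := fun x => by rw [two_zsmul, F2_two]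
  simp only [two', add_zero]

end Algebra2

section Rho
variable [LinearOrder V]
attribute [local instance] Classical.propDecidable

noncomputable def rho (K : SC V) : RK K →+ F2 K :=
  Finsupp.mapRange.addMonoidHom (Int.castAddHom (ZMod 2))

lemma rho_mk (K : SC V) (p : Finset V × Finset V) : rho K (RK.mk K p) = mk2 K p := by
  unfold RK.mk mk2
  split_ifs <;> simp [rho]

lemma rho_smul (K : SC V) (c : ℤ) (x : RK K) : rho K (c • x) = (c : ZMod 2) • rho K x := by
  rw [map_zsmul, Int.cast_smul_eq_zsmul]

lemma neg_one_pow_cast (k : ℕ) : (((-1 : ℤ) ^ k : ℤ) : ZMod 2) = 1 := by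
  have : (-1 : ZMod 2) = 1 := by decide
  push_cast
  rw [this, one_pow]

lemma rho_dB (K : SC V) (p : Finset V × Finset V) : rho K (dB K p) = dB2 K p := by
  unfold dB dB2
  rw [map_sum]
  refine Finset.sum_congr rfl fun j _ => ?_
  rw [rho_smul, rho_mk, eps, neg_one_pow_cast, one_smul]

lemma rho_mulB (K : SC V) (p q : Finset V × Finset V) :
    rho K (mulB K p q) = mulB2 K p q := by
  unfold mulB mulB2
  split_ifs
  · rw [rho_smul, rho_mk, shuffleSign, neg_one_pow_cast, one_smul]
  · simp

lemma rho_single (K : SC V) (p : {p : Finset V × Finset V // K.admissible p}) (c : ℤ) :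
    rho K (Finsupp.single p c) = Finsupp.single p (c : ZMod 2) := by
  simp [rho]

lemma dR_add (K : SC V) (x y : RK K) : dR K (x + y) = dR K x + dR K y := by
  unfold dR
  exact Finsupp.sum_add_index' (by simp) (by intros; rw [add_smul])

lemma dR_single (K : SC V) (p : {p : Finset V × Finset V // K.admissible p}) (c : ℤ) :
    dR K (Finsupp.single p c) = c • dB K p.val := by
  unfold dR
  exact Finsupp.sum_single_index (by simp)

lemma mulR_add_left (K : SC V) (x x' y : RK K) :
    mulR K (x + x') y = mulR K x y + mulR K x' y := by
  unfold mulR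
  refine Finsupp.sum_add_index' (by simp) ?_
  intro p c c'
  rw [← Finsupp.sum_add]
  refine Finsupp.sum_congr fun q _ => ?_
  rw [← add_smul]; ring_nf

lemma mulR_single_add (K : SC V) (p : {p : Finset V × Finset V // K.admissible p}) (c : ℤ)
    (y y' : RK K) :
    mulR K (Finsupp.single p c) (y + y') =
      mulR K (Finsupp.single p c) y + mulR K (Finsupp.single p c) y' := by
  unfold mulR
  rw [Finsupp.sum_single_index (by simp), Finsupp.sum_single_index (by simp),
    Finsupp.sum_single_index (by simp)]
  refine Finsupp.sum_add_index' (by simp) ?_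
  intro q c' c''
  rw [← add_smul]; ring_nf

lemma mulR_single_single (K : SC V) (p q : {p : Finset V × Finset V // K.admissible p})
    (c c' : ℤ) :
    mulR K (Finsupp.single p c) (Finsupp.single q c') = (c * c') • mulB K p.val q.val := by
  unfold mulR
  rw [Finsupp.sum_single_index (by simp), Finsupp.sum_single_index (by simp)]

lemma rho_dR (K : SC V) (x : RK K) : rho K (dR K x) = D2 K (rho K x) := by
  induction x using Finsupp.induction_linear with
  | zero => simp [dR]
  | add f g hf hg => rw [dR_add, map_add, map_add, map_add, hf, hg]
  | single p c =>
    rw [dR_single, rho_smul, rho_dB, rho_single, D2, Finsupp.linearCombination_single]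

lemma rho_mulR (K : SC V) (x y : RK K) :
    rho K (mulR K x y) = M2 K (rho K x) (rho K y) := by
  induction x using Finsupp.induction_linear with
  | zero => simp [mulR]
  | add f g hf hg =>
    rw [mulR_add_left, map_add, map_add, map_add, LinearMap.add_apply, hf, hg]
  | single p c =>
    induction y using Finsupp.induction_linear with
    | zero => simp [mulR]
    | add f g hf hg => rw [mulR_single_add, map_add, map_add, map_add, hf, hg]
    | single q c' =>
      rw [mulR_single_single, rho_smul, rho_mulB, rho_single, rho_single, M2,
        Finsupp.linearCombination_single, LinearMap.smul_apply,
        Finsupp.linearCombination_single, smul_smul]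
      push_cast; rfl

end Rho

section Coef
attribute [local instance] Classical.propDecidable

/-- Adjacency of two vertices of `K` (they are distinct and lie in a common face). -/
def SC.Adj (K : SC V) (i j : V) : Prop := i ≠ j ∧ ∃ s ∈ K.faces, i ∈ s ∧ j ∈ s

lemma SC.Adj.symm {K : SC V} {i j : V} (h : K.Adj i j) : K.Adj j i :=
  ⟨h.1.symm, h.2.imp fun _ h => ⟨h.1, h.2.2, h.2.1⟩⟩

lemma SC.Adj.face {K : SC V} {i j : V} [DecidableEq V] (h : K.Adj i j) :
    ({i, j} : Finset V) ∈ K.faces := by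
  obtain ⟨_, s, hs, hi, hj⟩ := h
  refine K.down_closed s hs _ ?_
  intro t ht
  rcases Finset.mem_insert.1 ht with rfl | ht
  · exact hi
  · rw [Finset.mem_singleton.1 ht]; exact hj

lemma SC.Adj.single {K : SC V} {i j : V} (h : K.Adj i j) :
    ({i} : Finset V) ∈ K.faces := by
  obtain ⟨_, s, hs, hi, hj⟩ := h
  exact K.down_closed s hs _ (Finset.singleton_subset_iff.2 hi)

/-- Coefficient of a monomial. -/
noncomputable def co (K : SC V) (x : F2 K) (J I : Finset V) : ZMod 2 :=
  if h : K.admissible (J, I) then x ⟨(J, I), h⟩ else 0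

lemma co_zero (K : SC V) (J I : Finset V) : co K 0 J I = 0 := by
  unfold co; split_ifs <;> rfl

lemma co_add (K : SC V) (x y : F2 K) (J I : Finset V) :
    co K (x + y) J I = co K x J I + co K y J I := by
  unfold co; split_ifs <;> simp

lemma co_sum {ι : Type} (K : SC V) (s : Finset ι) (f : ι → F2 K) (J I : Finset V) :
    co K (∑ k ∈ s, f k) J I = ∑ k ∈ s, co K (f k) J I := by
  induction s using Finset.induction_on with
  | empty => simp [co_zero]
  | insert a s ha ih => rw [Finset.sum_insert ha, Finset.sum_insert ha, co_add, ih]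

lemma co_mk2 (K : SC V) (p : Finset V × Finset V) (J I : Finset V)
    (h : K.admissible (J, I)) :
    co K (mk2 K p) J I = if p = (J, I) then 1 else 0 := by
  unfold co
  rw [dif_pos h]
  by_cases hp : K.admissible p
  · rw [mk2_of K hp, Finsupp.single_apply]
    simp only [Subtype.mk.injEq]
  · rw [mk2_not K hp, if_neg]
    · rfl
    · rintro rfl; exact hp h

noncomputable def ev (K : SC V) (T : Finset V) (x : F2 K) (i : V) : ZMod 2 :=
  co K x (T.erase i) {i}

noncomputable def ev2 (K : SC V) (T : Finset V) (x : F2 K) (i j : V) : ZMod 2 :=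
  co K x ((T.erase i).erase j) {i, j}

lemma ev2_add (K : SC V) (T : Finset V) (x y : F2 K) (i j : V) :
    ev2 K T (x + y) i j = ev2 K T x i j + ev2 K T y i j := co_add _ _ _ _ _

lemma ev2_comm (K : SC V) (T : Finset V) (x : F2 K) (i j : V) :
    ev2 K T x i j = ev2 K T x j i := by
  unfold ev2
  rw [Finset.erase_right_comm, Finset.pair_comm]

lemma adm1 (K : SC V) (T : Finset V) {i : V} (h : ({i} : Finset V) ∈ K.faces) :
    K.admissible (T.erase i, {i}) :=
  ⟨by simp, h⟩

lemma adm2 (K : SC V) (T : Finset V) {i j : V} (h : K.Adj i j) :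
    K.admissible ((T.erase i).erase j, {i, j}) :=
  ⟨by simp, h.face⟩

lemma ev2_D (K : SC V) (T : Finset V) (x : F2 K) {i j : V} (hi : i ∈ T) (hj : j ∈ T)
    (h : K.Adj i j) : ev2 K T (D2 K x) i j = ev K T x i + ev K T x j := by
  have hne := h.1
  unfold ev2 ev
  induction x using F2_induction with
  | h0 => simp [co_zero]
  | ha x y hx hy => simp only [map_add, co_add, hx, hy]; ring
  | hm p hp =>
    rw [D2_mk2 K p hp.1, dB2, co_sum]
    simp only [co_mk2 K _ _ _ (adm2 K T h), co_mk2 K _ _ _ (adm1 K T h.single),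
      co_mk2 K _ _ _ (adm1 K T h.symm.single)]
    have key : ∀ k ∈ p.1, (p.1.erase k, insert k p.2) = ((T.erase i).erase j, ({i, j} : Finset V)) →
        (k = j ∧ p = (T.erase i, {i})) ∨ (k = i ∧ p = (T.erase j, {j})) := by
      intro k hk he
      have h1 : p.1.erase k = (T.erase i).erase j := congrArg Prod.fst he
      have h2 : insert k p.2 = ({i, j} : Finset V) := congrArg Prod.snd he
      have hk2 : k ∉ p.2 := Finset.disjoint_left.1 hp.1 hk
      have hp2 : p.2 = ({i, j} : Finset V).erase k := by
        rw [← h2, Finset.erase_insert hk2]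
      have hp1 : p.1 = insert k ((T.erase i).erase j) := by
        rw [← h1, Finset.insert_erase hk]
      have hkm : k ∈ ({i, j} : Finset V) := by rw [← h2]; simp
      rcases Finset.mem_insert.1 hkm with rfl | hkm
      · right
        refine ⟨rfl, Prod.ext ?_ ?_⟩
        · rw [hp1, Finset.erase_right_comm, Finset.insert_erase]
          simp [hne, hi]
        · rw [hp2, Finset.erase_insert]
          simpa using hne
      · left
        rw [Finset.mem_singleton] at hkm
        subst hkm
        refine ⟨rfl, Prod.ext ?_ ?_⟩
        · rw [hp1, Finset.insert_erase]
          simp [hne.symm, hj]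
        · rw [hp2, Finset.pair_comm, Finset.erase_insert]
          simpa using hne.symm
    by_cases c1 : p = (T.erase i, {i})
    · have c2 : p ≠ (T.erase j, {j}) := by
        rw [c1]; intro h'
        exact hne (Finset.singleton_injective (congrArg Prod.snd h'))
      rw [if_pos c1, if_neg c2, add_zero, Finset.sum_eq_single j]
      · rw [if_pos]; rw [c1]; simp only; rw [Finset.pair_comm]
      · intro k hk hkj
        rw [if_neg]
        intro he
        rcases key k hk he with h' | h'
        · exact hkj h'.1
        · exact c2 h'.2
      · intro h'; exact absurd (by rw [c1]; simp [hne.symm, hj]) h'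
    · by_cases c2 : p = (T.erase j, {j})
      · rw [if_pos c2, if_neg c1, zero_add, Finset.sum_eq_single i]
        · rw [if_pos]; rw [c2]; simp only; rw [Finset.erase_right_comm]
        · intro k hk hkj
          rw [if_neg]
          intro he
          rcases key k hk he with h' | h'
          · exact c1 h'.2
          · exact hkj h'.1
        · intro h'; exact absurd (by rw [c2]; simp [hne, hi]) h'
      · rw [if_neg c1, if_neg c2, add_zero]
        refine Finset.sum_eq_zero fun k hk => if_neg fun he => ?_
        rcases key k hk he with h' | h'
        · exact c1 h'.2
        · exact c2 h'.2

lemma ev2_mul (K : SC V) (A T : Finset V) (x : F2 K) {i j : V} (hi : i ∈ A) (hj : j ∈ T)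
    (hd : Disjoint A T) (h : K.Adj i j) :
    ev2 K (A ∪ T) (M2 K (mk2 K (A.erase i, {i})) x) i j = ev K T x j := by
  have hiT : i ∉ T := Finset.disjoint_left.1 hd hi
  have hjA : j ∉ A := Finset.disjoint_right.1 hd hj
  unfold ev2 ev
  induction x using F2_induction with
  | h0 => simp [co_zero]
  | ha x y hx hy => simp only [map_add, co_add, hx, hy]
  | hm q hq =>
    rw [M2_mk2, mulB2, co_mk2 K _ _ _ (adm1 K T h.symm.single)]
    by_cases c : q = (T.erase j, {j})
    · rw [if_pos c, c, if_pos, co_mk2 K _ _ _ (adm2 K (A ∪ T) h), if_pos]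
      · refine Prod.ext ?_ ?_
        · simp only
          ext t
          simp only [Finset.mem_union, Finset.mem_erase]
          by_cases h1 : t = i
          · subst h1; simp [hiT]
          · by_cases h2 : t = j
            · subst h2; simp [hjA]
            · simp [h1, h2]
        · rfl
      · rw [Finset.disjoint_left]
        intro t ht ht'
        have h1 : t ∈ A := by
          rcases Finset.mem_union.1 ht with ht | ht
          · exact Finset.mem_of_mem_erase ht
          · rw [Finset.mem_singleton.1 ht]; exact hi
        have h2 : t ∈ T := by
          rcases Finset.mem_union.1 ht' with ht | ht
          · exact Finset.mem_of_mem_erase ht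
          · rw [Finset.mem_singleton.1 ht]; exact hj
        exact Finset.disjoint_left.1 hd h1 h2
    · rw [if_neg c]
      split_ifs with hdis
      · rw [co_mk2 K _ _ _ (adm2 K (A ∪ T) h), if_neg]
        intro he
        apply c
        have h1 : A.erase i ∪ q.1 = ((A ∪ T).erase i).erase j := congrArg Prod.fst he
        have h2 : {i} ∪ q.2 = ({i, j} : Finset V) := congrArg Prod.snd he
        simp only [Finset.disjoint_union_left, Finset.disjoint_union_right] at hdis
        obtain ⟨⟨d1, d2⟩, d3, d4⟩ := hdis
        refine Prod.ext ?_ ?_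
        · ext t
          simp only [Finset.mem_erase]
          have h1t : t ∈ A.erase i ∪ q.1 ↔ t ∈ ((A ∪ T).erase i).erase j := by rw [h1]
          simp only [Finset.mem_union, Finset.mem_erase] at h1t
          have e1 : t ∈ A → t ≠ i → t ∉ q.1 := fun a b =>
            Finset.disjoint_left.1 d1 (Finset.mem_erase.2 ⟨b, a⟩)
          have e2 : t = i → t ∉ q.1 := fun a =>
            Finset.disjoint_left.1 d2 (Finset.mem_singleton.2 a)
          have e3 : t ∈ A → t ∉ T := fun a => Finset.disjoint_left.1 hd a
          have e4 : t = i → t ∉ T := fun a => a ▸ hiT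
          tauto
        · have : i ∉ q.2 := Finset.disjoint_left.1 d4 (Finset.mem_singleton_self i)
          rw [← Finset.insert_eq] at h2
          have h3 : q.2 = ({i, j} : Finset V).erase i := by
            rw [← h2, Finset.erase_insert this]
          rw [h3, Finset.erase_insert]
          simpa using h.1
      · exact co_zero _ _ _

lemma ev2_mul_zero (K : SC V) (A S : Finset V) (x : F2 K) {i k l : V}
    (hk : i ≠ k) (hl : i ≠ l) (h : K.Adj k l) :
    ev2 K S (M2 K (mk2 K (A.erase i, {i})) x) k l = 0 := by
  unfold ev2
  induction x using F2_induction with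
  | h0 => simp [co_zero]
  | ha x y hx hy => simp only [map_add, co_add, hx, hy, add_zero]
  | hm q hq =>
    rw [M2_mk2, mulB2]
    split_ifs with hdis
    · rw [co_mk2 K _ _ _ (adm2 K S h), if_neg]
      intro he
      have h2 : {i} ∪ q.2 = ({k, l} : Finset V) := congrArg Prod.snd he
      have : i ∈ ({k, l} : Finset V) := by rw [← h2]; simp
      simp [hk, hl] at this
    · exact co_zero _ _ _

/-- Nontriviality of the Massey product, modulo 2. -/
lemma massey_nontrivial (K : SC V) (A B C : Finset V) (p0 p1 p2 p3 p4 : V)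
    (hAB : Disjoint A B) (hAC : Disjoint A C) (hBC : Disjoint B C)
    (m0 : p0 ∈ A) (m1 : p1 ∈ C) (m2 : p2 ∈ B) (m3 : p3 ∈ C) (m4 : p4 ∈ B)
    (n24 : p2 ≠ p4) (n13 : p1 ≠ p3)
    (e01 : K.Adj p0 p1) (e12 : K.Adj p1 p2) (e23 : K.Adj p2 p3) (e34 : K.Adj p3 p4)
    (e40 : K.Adj p4 p0)
    (hL : ∀ e : V → ZMod 2,
      (∀ i ∈ A ∪ B, ∀ j ∈ A ∪ B, i ≠ p0 → j ≠ p0 → K.Adj i j → e i = e j) → e p2 = e p4)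
    (W₁ W₂ T : F2 K)
    (h1 : D2 K W₁ = M2 K (mk2 K (A.erase p0, {p0})) (mk2 K (B.erase p4, {p4})))
    (h2 : D2 K W₂ = M2 K (mk2 K (B.erase p4, {p4})) (mk2 K (C.erase p3, {p3}))) :
    M2 K (mk2 K (A.erase p0, {p0})) W₂ + M2 K W₁ (mk2 K (C.erase p3, {p3})) + D2 K T ≠ 0 := by
  have nAB : ∀ {x y : V}, x ∈ A → y ∈ B → x ≠ y := fun hx hy h =>
    Finset.disjoint_left.1 hAB hx (h ▸ hy)
  have nAC : ∀ {x y : V}, x ∈ A → y ∈ C → x ≠ y := fun hx hy h =>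
    Finset.disjoint_left.1 hAC hx (h ▸ hy)
  have nBC : ∀ {x y : V}, x ∈ B → y ∈ C → x ≠ y := fun hx hy h =>
    Finset.disjoint_left.1 hBC hx (h ▸ hy)
  have two : ∀ x : ZMod 2, x + x = 0 := by decide
  have eqz : ∀ x y : ZMod 2, x + y = 0 → x = y := by decide
  -- first primitive
  have k1 : ev K (A ∪ B) W₁ p2 = ev K (A ∪ B) W₁ p4 := by
    apply hL (ev K (A ∪ B) W₁)
    intro i hi j hj hi0 hj0 hij
    apply eqz
    rw [← ev2_D K (A ∪ B) W₁ hi hj hij, h1, ev2_mul_zero K A _ _ hi0.symm hj0.symm hij]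
  -- second primitive
  have u1 : p1 ∈ B ∪ C := Finset.mem_union_right _ m1
  have u2 : p2 ∈ B ∪ C := Finset.mem_union_left _ m2
  have u3 : p3 ∈ B ∪ C := Finset.mem_union_right _ m3
  have u4 : p4 ∈ B ∪ C := Finset.mem_union_left _ m4
  have k2 : ev K (B ∪ C) W₂ p1 = ev K (B ∪ C) W₂ p2 := by
    apply eqz
    rw [← ev2_D K (B ∪ C) W₂ u1 u2 e12, h2, ev2_mul_zero K B _ _ (nBC m4 m1) n24.symm e12]
  have k3 : ev K (B ∪ C) W₂ p2 = ev K (B ∪ C) W₂ p3 := by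
    apply eqz
    rw [← ev2_D K (B ∪ C) W₂ u2 u3 e23, h2, ev2_mul_zero K B _ _ n24.symm (nBC m4 m3) e23]
  have k4 : ev K (B ∪ C) W₂ p4 + ev K (B ∪ C) W₂ p3 = 1 := by
    rw [← ev2_D K (B ∪ C) W₂ u4 u3 e34.symm, h2, ev2_mul K B C _ m4 m3 hBC e34.symm]
    unfold ev
    rw [co_mk2 K _ _ _ (adm1 K C e34.single), if_pos rfl]
  intro hz
  let S := A ∪ (B ∪ C)
  have hS : S = C ∪ (A ∪ B) := by
    ext t; simp only [S, Finset.mem_union]; tauto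
  have dA : Disjoint A (B ∪ C) := Finset.disjoint_union_right.2 ⟨hAB, hAC⟩
  have dC : Disjoint C (A ∪ B) := Finset.disjoint_union_right.2 ⟨hAC.symm, hBC.symm⟩
  have s0 : p0 ∈ S := Finset.mem_union_left _ m0
  have s1 : p1 ∈ S := Finset.mem_union_right _ u1
  have s2 : p2 ∈ S := Finset.mem_union_right _ u2
  have s3 : p3 ∈ S := Finset.mem_union_right _ u3
  have s4 : p4 ∈ S := Finset.mem_union_right _ u4
  have hev : ∀ i j, ev2 K S (M2 K (mk2 K (A.erase p0, {p0})) W₂) i j +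
      ev2 K S (M2 K (mk2 K (C.erase p3, {p3})) W₁) i j + ev2 K S (D2 K T) i j = 0 := by
    intro i j
    rw [M2_comm K (mk2 K (C.erase p3, {p3})) W₁, ← ev2_add, ← ev2_add, hz]
    exact co_zero _ _ _
  have q01 := hev p0 p1
  rw [ev2_D K S T s0 s1 e01, ev2_mul K A (B ∪ C) W₂ m0 u1 dA e01,
    ev2_mul_zero K C _ _ (nAC m0 m3).symm n13.symm e01] at q01
  have q12 := hev p1 p2
  rw [ev2_D K S T s1 s2 e12, ev2_mul_zero K A _ _ (nAC m0 m1) (nAB m0 m2) e12,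
    ev2_mul_zero K C _ _ n13.symm (nBC m2 m3).symm e12] at q12
  have q23 := hev p3 p2
  rw [ev2_D K S T s3 s2 e23.symm, ev2_mul_zero K A _ _ (nAC m0 m3) (nAB m0 m2) e23.symm, hS,
    ev2_mul K C (A ∪ B) W₁ m3 (Finset.mem_union_right _ m2) dC e23.symm, ← hS] at q23
  have q34 := hev p3 p4
  rw [ev2_D K S T s3 s4 e34, ev2_mul_zero K A _ _ (nAC m0 m3) (nAB m0 m4) e34, hS,
    ev2_mul K C (A ∪ B) W₁ m3 (Finset.mem_union_right _ m4) dC e34, ← hS] at q34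
  have q40 := hev p0 p4
  rw [ev2_D K S T s0 s4 e40.symm, ev2_mul K A (B ∪ C) W₂ m0 u4 dA e40.symm,
    ev2_mul_zero K C _ _ (nAC m0 m3).symm (nBC m4 m3).symm e40.symm] at q40
  rw [k2, k3] at q01
  rw [k1] at q23
  generalize ev K (A ∪ B) W₁ p4 = x at *
  generalize ev K (B ∪ C) W₂ p4 = y at *
  generalize ev K (B ∪ C) W₂ p3 = y' at *
  generalize ev K S T p0 = t0 at *
  generalize ev K S T p1 = t1 at *
  generalize ev K S T p2 = t2 at *
  generalize ev K S T p3 = t3 at *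
  generalize ev K S T p4 = t4 at *
  have : y + y' = 0 := by
    linear_combination q01 + q12 + q23 + q34 + q40 - two t0 - two t1 - two t2 - two t3 - two t4
      - two x
  rw [this] at k4
  exact absurd k4 (by decide)

end Coef

section Integral
variable [LinearOrder V]
attribute [local instance] Classical.propDecidable

lemma mk_not (K : SC V) {p : Finset V × Finset V} (h : ¬ K.admissible p) :
    RK.mk K p = 0 := dif_neg h

lemma dR_zero (K : SC V) : dR K 0 = 0 := by simp [dR]

lemma dR_smul (K : SC V) (c : ℤ) (x : RK K) : dR K (c • x) = c • dR K x :=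
  map_zsmul (AddMonoidHom.mk' (dR K) (dR_add K)) c x

lemma mulR_add_right (K : SC V) (x y y' : RK K) :
    mulR K x (y + y') = mulR K x y + mulR K x y' := by
  induction x using Finsupp.induction_linear with
  | zero => simp [mulR]
  | add f g hf hg => rw [mulR_add_left, mulR_add_left, mulR_add_left, hf, hg]; abel
  | single p c => exact mulR_single_add K p c y y'

lemma mulR_smul_left (K : SC V) (c : ℤ) (x y : RK K) : mulR K (c • x) y = c • mulR K x y :=
  map_zsmul (AddMonoidHom.mk' (fun x => mulR K x y) (fun a b => mulR_add_left K a b y)) c x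

lemma mulR_smul_right (K : SC V) (c : ℤ) (x y : RK K) : mulR K x (c • y) = c • mulR K x y :=
  map_zsmul (AddMonoidHom.mk' (fun y => mulR K x y) (fun a b => mulR_add_right K x a b)) c y

lemma dR_mk (K : SC V) (p : Finset V × Finset V) (h : K.admissible p) :
    dR K (RK.mk K p) = dB K p := by
  rw [RK.mk, dif_pos h, dR_single, one_smul]

lemma mulR_mk (K : SC V) (p q : Finset V × Finset V) (hp : K.admissible p)
    (hq : K.admissible q) : mulR K (RK.mk K p) (RK.mk K q) = mulB K p q := by
  rw [RK.mk, RK.mk, dif_pos hp, dif_pos hq, mulR_single_single, one_mul, one_smul]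

lemma mk_pair_zero (K : SC V) (J : Finset V) {i j : V} (hij : j ≠ i) (h : ¬ K.Adj i j) :
    RK.mk K (J, insert j {i}) = 0 := by
  refine mk_not K fun h' => h ⟨hij.symm, _, h'.2, ?_, ?_⟩ <;> simp

lemma dR_star_zero (K : SC V) (T : Finset V) (i : V) (hi : ({i} : Finset V) ∈ K.faces)
    (h : ∀ j ∈ T, ¬ K.Adj i j) : dR K (RK.mk K (T.erase i, {i})) = 0 := by
  rw [dR_mk K _ (adm1 K T hi), dB]
  refine Finset.sum_eq_zero fun j hj => ?_
  have hj' := Finset.mem_erase.1 hj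
  rw [mk_pair_zero K _ hj'.1 (h j hj'.2), smul_zero]

lemma dR_star_one (K : SC V) (T : Finset V) (i k : V) (hi : ({i} : Finset V) ∈ K.faces)
    (hk : k ∈ T) (hki : k ≠ i) (h : ∀ j ∈ T, K.Adj i j → j = k) :
    dR K (RK.mk K (T.erase i, {i})) =
      eps (T.erase i) k • RK.mk K ((T.erase i).erase k, insert k {i}) := by
  rw [dR_mk K _ (adm1 K T hi), dB]
  rw [Finset.sum_eq_single k]
  · intro j hj hjk
    have hj' := Finset.mem_erase.1 hj
    rw [mk_pair_zero K _ hj'.1 (fun h' => hjk (h j hj'.2 h')), smul_zero]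
  · intro h'; exact absurd (Finset.mem_erase.2 ⟨hki, hk⟩) h'

lemma mul_star (K : SC V) (A B : Finset V) (i k : V)
    (hi : ({i} : Finset V) ∈ K.faces) (hk : ({k} : Finset V) ∈ K.faces)
    (hiA : i ∈ A) (hkB : k ∈ B) (hd : Disjoint A B) :
    mulR K (RK.mk K (A.erase i, {i})) (RK.mk K (B.erase k, {k})) =
      shuffleSign (A.erase i) (B.erase k) •
        RK.mk K (((A ∪ B).erase i).erase k, insert k {i}) := by
  rw [mulR_mk K _ _ (adm1 K A hi) (adm1 K B hk), mulB, if_pos]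
  · have e1 : A.erase i ∪ B.erase k = ((A ∪ B).erase i).erase k := by
      have h1 : i ∉ B := Finset.disjoint_left.1 hd hiA
      have h2 : k ∉ A := Finset.disjoint_right.1 hd hkB
      rw [Finset.erase_union_distrib, Finset.erase_union_distrib, Finset.erase_eq_of_notMem h1,
        Finset.erase_eq_of_notMem (s := A.erase i) (fun h => h2 (Finset.mem_of_mem_erase h))]
    have e2 : ({i} ∪ {k} : Finset V) = insert k {i} := by
      rw [Finset.union_comm]; rfl
    simp only [e1, e2]
  · refine hd.mono ?_ ?_
    · exact Finset.union_subset (Finset.erase_subset _ _) (Finset.singleton_subset_iff.2 hiA)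
    · exact Finset.union_subset (Finset.erase_subset _ _) (Finset.singleton_subset_iff.2 hkB)

lemma sq_sign (k : ℕ) : ((-1 : ℤ) ^ k) * (-1) ^ k = 1 := by
  rw [← mul_pow]; simp

lemma primitive (K : SC V) (A B : Finset V) (i k : V)
    (hi : ({i} : Finset V) ∈ K.faces) (hk : ({k} : Finset V) ∈ K.faces)
    (hiA : i ∈ A) (hkB : k ∈ B) (hd : Disjoint A B)
    (h : ∀ j ∈ A ∪ B, K.Adj i j → j = k) :
    ∃ c : ℤ, dR K (c • RK.mk K ((A ∪ B).erase i, {i})) =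
      mulR K (RK.mk K (A.erase i, {i})) (RK.mk K (B.erase k, {k})) := by
  have hki : k ≠ i := fun e => Finset.disjoint_left.1 hd hiA (e ▸ hkB)
  refine ⟨shuffleSign (A.erase i) (B.erase k) * eps ((A ∪ B).erase i) k, ?_⟩
  rw [dR_smul, dR_star_one K (A ∪ B) i k hi (Finset.mem_union_right _ hkB) hki h,
    mul_star K A B i k hi hk hiA hkB hd, smul_smul, mul_assoc]
  rw [show eps ((A ∪ B).erase i) k * eps ((A ∪ B).erase i) k = 1 from sq_sign _, mul_one]

lemma homog_add (K : SC V) {x y : RK K} {k : ℕ} (hx : homogTotal K x k)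
    (hy : homogTotal K y k) : homogTotal K (x + y) k := by
  intro p hp
  rcases Finset.mem_union.1 (Finsupp.support_add hp) with h | h
  · exact hx p h
  · exact hy p h

lemma homog_smul (K : SC V) {x : RK K} {k : ℕ} (c : ℤ) (hx : homogTotal K x k) :
    homogTotal K (c • x) k := fun p hp => hx p (Finsupp.support_smul hp)

lemma homog_mk (K : SC V) (p : Finset V × Finset V) {k : ℕ}
    (h : p.1.card + 2 * p.2.card = k) : homogTotal K (RK.mk K p) k := by
  unfold RK.mk
  split_ifs with h'
  · intro q hq
    have := Finsupp.support_single_subset hq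
    rw [Finset.mem_singleton.1 this]
    exact h
  · intro q hq; simp at hq

lemma homog_star (K : SC V) (T : Finset V) {i : V} (hi : i ∈ T) {k : ℕ} (hk : T.card + 1 = k) :
    homogTotal K (RK.mk K (T.erase i, {i})) k := by
  apply homog_mk
  have := Finset.card_erase_add_one hi
  simp only [Finset.card_singleton]
  omega

lemma homog_mul_star (K : SC V) (A B : Finset V) (i k : V)
    (hi : ({i} : Finset V) ∈ K.faces) (hk : ({k} : Finset V) ∈ K.faces)
    (hiA : i ∈ A) (hkB : k ∈ B) (hd : Disjoint A B) {m : ℕ} (hm : A.card + B.card + 2 = m) :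
    homogTotal K (mulR K (RK.mk K (A.erase i, {i})) (RK.mk K (B.erase k, {k}))) m := by
  rw [mul_star K A B i k hi hk hiA hkB hd]
  apply homog_smul
  apply homog_mk
  have hki : k ≠ i := fun e => Finset.disjoint_left.1 hd hiA (e ▸ hkB)
  have h1 := Finset.card_erase_add_one (Finset.mem_union_left B hiA)
  have h2 : k ∈ (A ∪ B).erase i := Finset.mem_erase.2 ⟨hki, Finset.mem_union_right _ hkB⟩
  have h3 := Finset.card_erase_add_one h2
  have h4 := Finset.card_union_of_disjoint hd
  have h5 : (insert k ({i} : Finset V)).card = 2 := Finset.card_pair hki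
  simp only [h5]
  omega

/-- A configuration of vertices producing a nontrivial Massey product. -/
lemma massey_of_config (K : SC V) (A B C : Finset V) (p0 p1 p2 p3 p4 : V)
    (hAB : Disjoint A B) (hAC : Disjoint A C) (hBC : Disjoint B C)
    (cA : A.card = 3) (cB : 2 ≤ B.card) (cC : C.card = 2)
    (m0 : p0 ∈ A) (m1 : p1 ∈ C) (m2 : p2 ∈ B) (m3 : p3 ∈ C) (m4 : p4 ∈ B)
    (n24 : p2 ≠ p4) (n13 : p1 ≠ p3)
    (e01 : K.Adj p0 p1) (e12 : K.Adj p1 p2) (e23 : K.Adj p2 p3) (e34 : K.Adj p3 p4)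
    (e40 : K.Adj p4 p0)
    (hL : ∀ e : V → ZMod 2,
      (∀ i ∈ A ∪ B, ∀ j ∈ A ∪ B, i ≠ p0 → j ≠ p0 → K.Adj i j → e i = e j) → e p2 = e p4)
    (nA : ∀ j ∈ A, ¬ K.Adj p0 j) (nB : ∀ j ∈ B, ¬ K.Adj p4 j) (nC : ∀ j ∈ C, ¬ K.Adj p3 j)
    (n1 : ∀ j ∈ A ∪ B, K.Adj p0 j → j = p4) (n2 : ∀ j ∈ B ∪ C, K.Adj p4 j → j = p3) :
    ∃ n : ℕ, 5 ≤ n ∧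
      ∃ a b c : RK K,
        dR K a = 0 ∧ dR K b = 0 ∧ dR K c = 0 ∧
        homogTotal K a 4 ∧ homogTotal K b (n - 2) ∧ homogTotal K c 3 ∧
        (∃ w₁ : RK K, dR K w₁ = mulR K a b) ∧ (∃ w₂ : RK K, dR K w₂ = mulR K b c) ∧
        (∃ z ∈ MasseySet K 4 a b c, homogTotal K z (n + 4)) ∧
        (0 : RK K) ∉ MasseySet K 4 a b c := by
  have f0 := e01.single
  have f3 := e34.single
  have f4 := e40.single
  have da := dR_star_zero K A p0 f0 nA
  have db := dR_star_zero K B p4 f4 nB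
  have dc := dR_star_zero K C p3 f3 nC
  obtain ⟨c₁, hc₁⟩ := primitive K A B p0 p4 f0 f4 m0 m4 hAB n1
  obtain ⟨c₂, hc₂⟩ := primitive K B C p4 p3 f4 f3 m4 m3 hBC n2
  refine ⟨B.card + 3, by omega, RK.mk K (A.erase p0, {p0}), RK.mk K (B.erase p4, {p4}),
    RK.mk K (C.erase p3, {p3}), da, db, dc, homog_star K A m0 (by omega),
    homog_star K B m4 (by omega), homog_star K C m3 (by omega), ⟨_, hc₁⟩, ⟨_, hc₂⟩,
    ⟨_, ⟨_, _, _, _, _, 0, da, db, dc, ⟨0, by rw [dR_zero, add_zero]⟩,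
      ⟨0, by rw [dR_zero, add_zero]⟩, ⟨0, by rw [dR_zero, add_zero]⟩, hc₁, hc₂, rfl⟩, ?_⟩, ?_⟩
  · rw [dR_zero, add_zero]
    have cBC := Finset.card_union_of_disjoint hBC
    have cAB := Finset.card_union_of_disjoint hAB
    apply homog_add
    · apply homog_smul
      rw [mulR_smul_right]
      apply homog_smul
      exact homog_mul_star K A (B ∪ C) p0 p4 f0 f4 m0 (Finset.mem_union_left _ m4)
        (Finset.disjoint_union_right.2 ⟨hAB, hAC⟩) (by omega)
    · rw [mulR_smul_left]
      apply homog_smul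
      exact homog_mul_star K (A ∪ B) C p0 p3 f0 f3 (Finset.mem_union_left _ m0) m3
        (Finset.disjoint_union_left.2 ⟨hAC, hBC⟩) (by omega)
  · rintro ⟨a', b', c', w₁, w₂, t, da', db', dc', ⟨ta, ha⟩, ⟨tb, hb⟩, ⟨tc, hc⟩, hw₁, hw₂, hz⟩
    have ra := congrArg (rho K) ha
    have rb := congrArg (rho K) hb
    have rc := congrArg (rho K) hc
    rw [map_add, rho_mk, rho_dR] at ra rb rc
    have rda := congrArg (rho K) da
    have rdb := congrArg (rho K) db
    have rdc := congrArg (rho K) dc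
    rw [rho_dR, rho_mk, map_zero] at rda rdb rdc
    have rda' := congrArg (rho K) da'
    have rdb' := congrArg (rho K) db'
    have rdc' := congrArg (rho K) dc'
    rw [rho_dR, map_zero] at rda' rdb' rdc'
    have rw₁ := congrArg (rho K) hw₁
    have rw₂ := congrArg (rho K) hw₂
    rw [rho_dR, rho_mulR] at rw₁ rw₂
    have rz := congrArg (rho K) hz
    rw [map_add, map_add, map_zero, rho_smul, neg_one_pow_cast, one_smul, rho_mulR, rho_mulR,
      rho_dR] at rz
    obtain ⟨W₁, W₂, T, h1, h2, h3⟩ := massey_change K _ _ _ _ _ _ _ _ _ _ _ rdb rda rdc ra rb rc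
      rda' rdb' rdc' rw₁ rw₂
    rw [h3, add_assoc, ← map_add] at rz
    exact massey_nontrivial K A B C p0 p1 p2 p3 p4 hAB hAC hBC m0 m1 m2 m3 m4 n24 n13 e01 e12
      e23 e34 e40 hL W₁ W₂ _ h1 h2 rz.symm

end Integral

section Graph
variable [Fintype V]
attribute [local instance] Classical.propDecidable

lemma common_other (K : SC V)
    (hcom : ∀ x y, K.Adj x y → ∃ z w, z ≠ w ∧ ∀ t, (K.Adj t x ∧ K.Adj t y) ↔ (t = z ∨ t = w))
    {x y c : V} (h : K.Adj x y) (hc : K.Adj c x ∧ K.Adj c y) :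
    ∃ d, d ≠ c ∧ ∀ t, (K.Adj t x ∧ K.Adj t y) ↔ (t = c ∨ t = d) := by
  obtain ⟨z, w, hzw, H⟩ := hcom x y h
  rcases (H c).1 hc with rfl | rfl
  · exact ⟨w, hzw.symm, H⟩
  · exact ⟨z, hzw, fun t => by rw [H t]; tauto⟩

/-- Parity argument in the link of `p3`. -/
lemma link_parity (K : SC V) (v p2 p3 p4 : V)
    (hcom : ∀ x y, K.Adj x y → ∃ z w, z ≠ w ∧ ∀ t, (K.Adj t x ∧ K.Adj t y) ↔ (t = z ∨ t = w))
    (hv : K.Adj v p3) (n24 : p2 ≠ p4)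
    (h3 : ∀ t, (K.Adj t v ∧ K.Adj t p3) ↔ (t = p2 ∨ t = p4))
    (e : V → ZMod 2)
    (he : ∀ i j, K.Adj i p3 → K.Adj j p3 → i ≠ v → j ≠ v → K.Adj i j → e i = e j) :
    e p2 = e p4 := by
  let L : Finset V := Finset.univ.filter fun t => K.Adj t p3
  let Lv := L.erase v
  have mL : ∀ t, t ∈ L ↔ K.Adj t p3 := fun t => by simp [L]
  have mLv : ∀ t, t ∈ Lv ↔ t ≠ v ∧ K.Adj t p3 := fun t => by simp [Lv, L]
  have two : ∀ x : ZMod 2, x + x = 0 := by decide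
  have hX : ∑ q ∈ Lv ×ˢ Lv, (if K.Adj q.1 q.2 then e q.1 else 0) = 0 := by
    refine Finset.sum_involution (fun q _ => (q.2, q.1)) ?_ ?_ ?_ ?_
    · rintro ⟨i, j⟩ hq
      obtain ⟨hi, hj⟩ := Finset.mem_product.1 hq
      simp only at hi hj ⊢
      by_cases h : K.Adj i j
      · rw [if_pos h, if_pos h.symm, he i j ((mLv i).1 hi).2 ((mLv j).1 hj).2
          ((mLv i).1 hi).1 ((mLv j).1 hj).1 h, two]
      · rw [if_neg h, if_neg fun h' => h h'.symm, add_zero]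
    · rintro ⟨i, j⟩ hq hne heq
      simp only [Prod.mk.injEq] at heq hne
      obtain ⟨rfl, _⟩ := heq
      exact hne (if_neg fun h => h.1 rfl)
    · rintro ⟨i, j⟩ hq
      obtain ⟨hi, hj⟩ := Finset.mem_product.1 hq
      exact Finset.mem_product.2 ⟨hj, hi⟩
    · rintro ⟨i, j⟩ hq; rfl
  rw [Finset.sum_product] at hX
  have inner : ∀ i ∈ Lv, (∑ j ∈ Lv, if K.Adj i j then e i else 0) =
      if K.Adj i v then e i else 0 := by
    intro i hi
    obtain ⟨hiv, hi3⟩ := (mLv i).1 hi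
    obtain ⟨z, w, hzw, H⟩ := hcom i p3 hi3
    have hsum : (∑ j ∈ L, if K.Adj i j then e i else 0) = 0 := by
      rw [← Finset.sum_filter]
      have : L.filter (fun j => K.Adj i j) = {z, w} := by
        ext t
        rw [Finset.mem_filter, mL, Finset.mem_insert, Finset.mem_singleton, ← H t]
        exact ⟨fun h => ⟨h.2.symm, h.1⟩, fun h => ⟨h.2, h.1.symm⟩⟩
      rw [this, Finset.sum_pair hzw, two]
    rw [← Finset.add_sum_erase L _ ((mL v).2 hv)] at hsum
    have neg : ∀ x y : ZMod 2, x + y = 0 → y = x := by decide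
    exact neg _ _ hsum
  rw [Finset.sum_congr rfl inner, ← Finset.sum_filter] at hX
  have : Lv.filter (fun i => K.Adj i v) = {p2, p4} := by
    ext t
    rw [Finset.mem_filter, mLv, Finset.mem_insert, Finset.mem_singleton, ← h3 t]
    exact ⟨fun h => ⟨h.2, h.1.2⟩, fun h => ⟨⟨h.1.1, h.2⟩, h.1⟩⟩
  rw [this, Finset.sum_pair n24] at hX
  have eqz : ∀ x y : ZMod 2, x + y = 0 → x = y := by decide
  exact eqz _ _ hX

lemma exists_config (K : SC V)
    (hcom : ∀ x y, K.Adj x y → ∃ z w, z ≠ w ∧ ∀ t, (K.Adj t x ∧ K.Adj t y) ↔ (t = z ∨ t = w))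
    (hK4 : ∀ a b c d, K.Adj a b → K.Adj a c → K.Adj a d → K.Adj b c → K.Adj b d → K.Adj c d →
      False)
    (hC4 : ∀ a b c d, K.Adj a b → K.Adj b c → K.Adj c d → K.Adj d a → a ≠ c → b ≠ d →
      ¬ K.Adj a c → ¬ K.Adj b d → False)
    (v p3 : V) (hv3 : K.Adj v p3) (hdeg : (Finset.univ.filter fun t => K.Adj t v).card ≤ 5) :
    ∃ (A B C : Finset V) (p0 p1 p2 p3 p4 : V),
      Disjoint A B ∧ Disjoint A C ∧ Disjoint B C ∧ A.card = 3 ∧ 2 ≤ B.card ∧ C.card = 2 ∧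
      p0 ∈ A ∧ p1 ∈ C ∧ p2 ∈ B ∧ p3 ∈ C ∧ p4 ∈ B ∧ p2 ≠ p4 ∧ p1 ≠ p3 ∧
      K.Adj p0 p1 ∧ K.Adj p1 p2 ∧ K.Adj p2 p3 ∧ K.Adj p3 p4 ∧ K.Adj p4 p0 ∧
      (∀ e : V → ZMod 2,
        (∀ i ∈ A ∪ B, ∀ j ∈ A ∪ B, i ≠ p0 → j ≠ p0 → K.Adj i j → e i = e j) → e p2 = e p4) ∧
      (∀ j ∈ A, ¬ K.Adj p0 j) ∧ (∀ j ∈ B, ¬ K.Adj p4 j) ∧ (∀ j ∈ C, ¬ K.Adj p3 j) ∧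
      (∀ j ∈ A ∪ B, K.Adj p0 j → j = p4) ∧ (∀ j ∈ B ∪ C, K.Adj p4 j → j = p3) := by
  obtain ⟨p2, p4, n24, H3⟩ := hcom v p3 hv3
  obtain ⟨v2, a23⟩ := (H3 p2).2 (Or.inl rfl)
  obtain ⟨v4, a43⟩ := (H3 p4).2 (Or.inr rfl)
  obtain ⟨p1, n13, H2⟩ := common_other K hcom v2.symm ⟨hv3.symm, a23.symm⟩
  obtain ⟨p0, n03, H4⟩ := common_other K hcom v4.symm ⟨hv3.symm, a43.symm⟩
  obtain ⟨v1, a12⟩ := (H2 p1).2 (Or.inr rfl)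
  obtain ⟨v0, a04⟩ := (H4 p0).2 (Or.inr rfl)
  have x24 : ¬ K.Adj p2 p4 := fun h => hK4 v p3 p2 p4 hv3 v2.symm v4.symm a23.symm a43.symm h
  have n14 : p1 ≠ p4 := fun h => x24 (h ▸ a12).symm
  have n02 : p0 ≠ p2 := fun h => x24 (h ▸ a04)
  have x13 : ¬ K.Adj p1 p3 := fun h => by
    rcases (H3 p1).1 ⟨v1, h⟩ with h | h
    · exact a12.1 h
    · exact n14 h
  have x03 : ¬ K.Adj p0 p3 := fun h => by
    rcases (H3 p0).1 ⟨v0, h⟩ with h | h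
    · exact n02 h
    · exact a04.1 h
  have n01 : p0 ≠ p1 := by
    intro h
    rw [← h] at a12
    exact hC4 p2 p3 p4 p0 a23 a43.symm a04.symm a12 n24 n03.symm x24 fun h => x03 h.symm
  have x02 : ¬ K.Adj p0 p2 := fun h => by
    rcases (H2 p0).1 ⟨v0, h⟩ with h | h
    · exact n03 h
    · exact n01 h
  have x14 : ¬ K.Adj p1 p4 := fun h => by
    rcases (H4 p1).1 ⟨v1, h⟩ with h | h
    · exact n13 h
    · exact n01 h.symm
  have a01 : K.Adj p0 p1 := by
    obtain ⟨q, nq4, H0⟩ := common_other K hcom v0.symm ⟨v4, a04.symm⟩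
    obtain ⟨vq, aq0⟩ := (H0 q).2 (Or.inr rfl)
    have hsub : ({p0, p1, p2, p3, p4} : Finset V) ⊆ Finset.univ.filter fun t => K.Adj t v := by
      intro t ht
      simp only [Finset.mem_insert, Finset.mem_singleton] at ht
      rw [Finset.mem_filter]
      refine ⟨Finset.mem_univ _, ?_⟩
      rcases ht with rfl | rfl | rfl | rfl | rfl
      exacts [v0, v1, v2, hv3.symm, v4]
    have hc : ({p0, p1, p2, p3, p4} : Finset V).card = 5 := by
      rw [Finset.card_insert_of_notMem, Finset.card_insert_of_notMem,
        Finset.card_insert_of_notMem, Finset.card_insert_of_notMem, Finset.card_singleton]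
      · simpa using a43.1.symm
      · simp [a23.1, n24]
      · simp [a12.1, n13, n14]
      · simp [n01, n02, n03, a04.1]
    have heq := Finset.eq_of_subset_of_card_le hsub (by rw [hc]; exact hdeg)
    have hq : q ∈ ({p0, p1, p2, p3, p4} : Finset V) := by
      rw [heq, Finset.mem_filter]; exact ⟨Finset.mem_univ _, vq⟩
    simp only [Finset.mem_insert, Finset.mem_singleton] at hq
    rcases hq with h | h | h | h | h
    · exact absurd h aq0.1
    · rw [← h]; exact aq0.symm
    · exact absurd (h ▸ aq0.symm) x02
    · exact absurd (h ▸ aq0.symm) x03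
    · exact absurd h nq4
  obtain ⟨y1, ny1v, HY1⟩ := common_other K hcom a43.symm ⟨hv3, v4.symm⟩
  obtain ⟨b1, b14⟩ := (HY1 y1).2 (Or.inr rfl)
  have xv1 : ¬ K.Adj v y1 := fun h => hK4 v p3 p4 y1 hv3 v4.symm h a43.symm b1.symm b14.symm
  obtain ⟨y2, ny24, HY2⟩ := common_other K hcom b1.symm ⟨a43, b14.symm⟩
  obtain ⟨b2, b21⟩ := (HY2 y2).2 (Or.inr rfl)
  have ny2v : y2 ≠ v := fun h => xv1 (h ▸ b21)
  have ny12 : y1 ≠ p2 := fun h => x24 (h ▸ b14)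
  have ny22 : y2 ≠ p2 := fun h => by
    rw [h] at b21
    exact hC4 v p4 y1 p2 v4.symm b14.symm b21.symm v2 ny1v.symm n24.symm xv1
      fun h => x24 h.symm
  -- neighbours of `p0` in the link of `p3`
  have key : ∀ j, K.Adj j p3 → j ≠ v → K.Adj p0 j → j = p4 := by
    intro j hj hjv h0
    by_contra hj4
    by_cases hvj : K.Adj v j
    · rcases (H3 j).1 ⟨hvj.symm, hj⟩ with h | h
      · exact x02 (h ▸ h0)
      · exact hj4 h
    · exact hC4 v p0 j p3 v0.symm h0 hj hv3.symm hjv.symm n03 hvj x03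
  let L : Finset V := Finset.univ.filter fun t => K.Adj t p3
  let B : Finset V := L.filter fun t => t ≠ v ∧ t ≠ y1 ∧ t ≠ y2
  have mB : ∀ t, t ∈ B ↔ K.Adj t p3 ∧ t ≠ v ∧ t ≠ y1 ∧ t ≠ y2 := fun t => by simp [B, L]
  have mA : ∀ t, t ∈ ({y1, y2, p0} : Finset V) ↔ t = y1 ∨ t = y2 ∨ t = p0 := fun t => by simp
  have mC : ∀ t, t ∈ ({p1, p3} : Finset V) ↔ t = p1 ∨ t = p3 := fun t => by simp
  have ny10 : y1 ≠ p0 := fun h => x03 (h ▸ b1)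
  have ny20 : y2 ≠ p0 := fun h => x03 (h ▸ b2)
  have mB2 : p2 ∈ B := (mB p2).2 ⟨a23, v2.1, ny12.symm, ny22.symm⟩
  have mB4 : p4 ∈ B := (mB p4).2 ⟨a43, v4.1, b14.1.symm, ny24.symm⟩
  refine ⟨{y1, y2, p0}, B, {p1, p3}, p0, p1, p2, p3, p4, ?_, ?_, ?_, ?_, ?_, ?_, ?_, ?_, mB2, ?_,
    mB4, n24, n13, a01, a12, a23, a43.symm, a04.symm, ?_, ?_, ?_, ?_, ?_, ?_⟩
  · rw [Finset.disjoint_left]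
    intro t ht htB
    rw [mA] at ht
    rw [mB] at htB
    rcases ht with h | h | h
    · exact htB.2.2.1 h
    · exact htB.2.2.2 h
    · exact x03 (h ▸ htB.1)
  · rw [Finset.disjoint_left]
    intro t ht htC
    rw [mA] at ht
    rw [mC] at htC
    rcases ht with rfl | rfl | rfl <;> rcases htC with rfl | rfl
    · exact x13 b1
    · exact b1.1 rfl
    · exact x13 b2
    · exact b2.1 rfl
    · exact n01 rfl
    · exact n03 rfl
  · rw [Finset.disjoint_left]
    intro t ht htC
    rw [mB] at ht
    rw [mC] at htC
    rcases htC with rfl | rfl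
    · exact x13 ht.1
    · exact ht.1.1 rfl
  · rw [Finset.card_insert_of_notMem, Finset.card_insert_of_notMem, Finset.card_singleton]
    · simpa using ny20
    · simp [b21.1.symm, ny10]
  · have : ({p2, p4} : Finset V) ⊆ B := by
      intro t ht
      rcases Finset.mem_insert.1 ht with rfl | ht
      · exact mB2
      · rw [Finset.mem_singleton.1 ht]; exact mB4
    rw [← Finset.card_pair n24]
    exact Finset.card_le_card this
  · exact Finset.card_pair n13
  · simp
  · simp
  · simp
  · intro e he
    refine link_parity K v p2 p3 p4 hcom hv3 n24 H3 e ?_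
    intro i j hi hj hiv hjv hij
    have hin : ∀ t, K.Adj t p3 → t ≠ v → t ∈ ({y1, y2, p0} : Finset V) ∪ B := by
      intro t ht htv
      rw [Finset.mem_union, mA, mB]
      tauto
    exact he i (hin i hi hiv) j (hin j hj hjv) (fun h => x03 (h ▸ hi)) (fun h => x03 (h ▸ hj)) hij
  · intro j hj h
    rw [mA] at hj
    rcases hj with rfl | rfl | rfl
    · exact b14.1 (key _ b1 ny1v h)
    · exact ny24 (key _ b2 ny2v h)
    · exact h.1 rfl
  · intro j hj h
    rw [mB] at hj
    rcases (HY1 j).1 ⟨hj.1, h.symm⟩ with h' | h'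
    · exact hj.2.1 h'
    · exact hj.2.2.1 h'
  · intro j hj h
    rw [mC] at hj
    rcases hj with rfl | rfl
    · exact x13 h.symm
    · exact h.1 rfl
  · intro j hj h
    rw [Finset.mem_union, mA, mB] at hj
    rcases hj with (rfl | rfl | rfl) | hj
    · exact key _ b1 ny1v h
    · exact key _ b2 ny2v h
    · exact absurd rfl h.1
    · exact key _ hj.1 hj.2.1 h
  · intro j hj h
    rw [Finset.mem_union, mC, mB] at hj
    rcases hj with hj | rfl | rfl
    · rcases (HY1 j).1 ⟨hj.1, h.symm⟩ with h' | h'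
      · exact absurd h' hj.2.1
      · exact absurd h' hj.2.2.1
    · exact absurd h.symm x14
    · rfl

end Graph

section SphereFacts
variable [Fintype V] [DecidableEq V]

lemma adj_iff (K : SC V) (x y : V) : K.Adj x y ↔ x ≠ y ∧ ({x, y} : Finset V) ∈ K.faces :=
  ⟨fun h => ⟨h.1, h.face⟩, fun h => ⟨h.1, _, h.2, by simp, by simp⟩⟩

lemma flag_clique (K : SC V) (hS : IsSphere2 K) (hF : IsFlag K) (s : Finset V)
    (hs : s.Nonempty) (h : ∀ u ∈ s, ∀ w ∈ s, u ≠ w → K.Adj u w) : s ∈ K.faces :=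
  hF s hs (fun u _ => hS.1 u) (fun u hu w hw huw => (h u hu w hw huw).face)

lemma no_K4 (K : SC V) (hS : IsSphere2 K) (hF : IsFlag K) (a b c d : V)
    (ab : K.Adj a b) (ac : K.Adj a c) (ad : K.Adj a d) (bc : K.Adj b c) (bd : K.Adj b d)
    (cd : K.Adj c d) : False := by
  have hf : ({a, b, c, d} : Finset V) ∈ K.faces := by
    refine flag_clique K hS hF _ ⟨a, by simp⟩ ?_
    intro u hu w hw huw
    simp only [Finset.mem_insert, Finset.mem_singleton] at hu hw
    have := ab.symm; have := ac.symm; have := ad.symm; have := bc.symm; have := bd.symm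
    have := cd.symm
    rcases hu with rfl | rfl | rfl | rfl <;> rcases hw with rfl | rfl | rfl | rfl <;>
      first | assumption | exact absurd rfl huw
  have hc := hS.2.1 _ hf
  rw [Finset.card_insert_of_notMem, Finset.card_insert_of_notMem, Finset.card_insert_of_notMem,
    Finset.card_singleton] at hc
  · omega
  · simpa using cd.1
  · simp [bc.1, bd.1]
  · simp [ab.1, ac.1, ad.1]

lemma no_C4 (K : SC V) (hB : ¬ HasBelt K 4) (a b c d : V) (ab : K.Adj a b) (bc : K.Adj b c)
    (cd : K.Adj c d) (da : K.Adj d a) (nac : a ≠ c) (nbd : b ≠ d)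
    (xac : ¬ K.Adj a c) (xbd : ¬ K.Adj b d) : False := by
  have ba := ab.symm
  have cb := bc.symm
  have dc := cd.symm
  have ad := da.symm
  have xca : ¬ K.Adj c a := fun h => xac h.symm
  have xdb : ¬ K.Adj d b := fun h => xbd h.symm
  apply hB
  let f : ZMod 4 → V := ![a, b, c, d]
  have inj : Function.Injective f := by
    have h1 := ab.1; have h2 := bc.1; have h3 := cd.1; have h4 := da.1
    intro i j hij
    fin_cases i <;> fin_cases j <;> first | rfl | (exfalso; simp [f] at hij; tauto)
  have far : ∀ i j : ZMod 4, i ≠ j → K.Adj (f i) (f j) → (j = i + 1 ∨ i = j + 1) := by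
    intro i j hij h
    fin_cases i <;> fin_cases j <;>
      first
      | exact absurd rfl hij
      | exact absurd h xac
      | exact absurd h xca
      | exact absurd h xbd
      | exact absurd h xdb
      | exact Or.inl rfl
      | exact Or.inr rfl
  refine ⟨f, by norm_num, inj, ?_, ?_, ?_⟩
  · intro i
    fin_cases i
    exacts [ab.face, bc.face, cd.face, da.face]
  · intro i j hij h
    exact far i j hij ((adj_iff K _ _).2 ⟨fun e => hij (inj e), h⟩)
  · intro i j l hij hjl hil h
    have key : ∀ i j l : ZMod 4, i ≠ j → j ≠ l → i ≠ l → (j = i + 1 ∨ i = j + 1) →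
        (l = j + 1 ∨ j = l + 1) → (l = i + 1 ∨ i = l + 1) → False := by decide
    refine key i j l hij hjl hil (far i j hij ⟨fun e => hij (inj e), _, h, by simp, by simp⟩)
      (far j l hjl ⟨fun e => hjl (inj e), _, h, by simp, by simp⟩)
      (far i l hil ⟨fun e => hil (inj e), _, h, by simp, by simp⟩)

lemma common_two (K : SC V) (hS : IsSphere2 K) (hF : IsFlag K) (x y : V) (h : K.Adj x y) :
    ∃ z w, z ≠ w ∧ ∀ t, (K.Adj t x ∧ K.Adj t y) ↔ (t = z ∨ t = w) := by
  have hn := hS.2.2.2.1 {x, y} h.face (Finset.card_pair h.1)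
  have himg : {t | t ∈ K.faces ∧ t.card = 3 ∧ ({x, y} : Finset V) ⊆ t} =
      (fun t => insert t ({x, y} : Finset V)) '' {t | K.Adj t x ∧ K.Adj t y} := by
    ext s
    simp only [Set.mem_setOf_eq, Set.mem_image]
    constructor
    · rintro ⟨hs, hc, hsub⟩
      have : (s \ {x, y}).card = 1 := by
        rw [Finset.card_sdiff_of_subset hsub, hc, Finset.card_pair h.1]
      obtain ⟨t, ht⟩ := Finset.card_eq_one.1 this
      have htm : t ∈ s \ {x, y} := by rw [ht]; simp
      rw [Finset.mem_sdiff] at htm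
      have hx : x ∈ s := hsub (by simp)
      have hy : y ∈ s := hsub (by simp)
      refine ⟨t, ⟨⟨fun e => htm.2 (by simp [e]), s, hs, htm.1, hx⟩,
        ⟨fun e => htm.2 (by simp [e]), s, hs, htm.1, hy⟩⟩, ?_⟩
      rw [Finset.insert_eq, ← ht, Finset.sdiff_union_of_subset hsub]
    · rintro ⟨t, ⟨tx, ty⟩, rfl⟩
      refine ⟨?_, ?_, Finset.subset_insert _ _⟩
      · refine flag_clique K hS hF _ ⟨t, by simp⟩ ?_
        intro u hu w hw huw
        simp only [Finset.mem_insert, Finset.mem_singleton] at hu hw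
        have := tx.symm; have := ty.symm; have := h.symm
        rcases hu with rfl | rfl | rfl <;> rcases hw with rfl | rfl | rfl <;>
          first | assumption | exact absurd rfl huw
      · rw [Finset.card_insert_of_notMem, Finset.card_pair h.1]
        simp [tx.1, ty.1]
  rw [himg, Set.ncard_image_of_injOn, Set.ncard_eq_two] at hn
  · obtain ⟨z, w, hzw, H⟩ := hn
    refine ⟨z, w, hzw, fun t => ?_⟩
    have : t ∈ {t | K.Adj t x ∧ K.Adj t y} ↔ t ∈ ({z, w} : Set V) := by rw [H]
    simpa using this
  · rintro s ⟨sx, sy⟩ t ⟨tx, ty⟩ hst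
    have hm : s ∈ insert t ({x, y} : Finset V) := by
      have hst' : insert s ({x, y} : Finset V) = insert t {x, y} := hst
      rw [← hst']; simp
    simp only [Finset.mem_insert, Finset.mem_singleton] at hm
    rcases hm with h' | h' | h'
    · exact h'
    · exact absurd h' sx.1
    · exact absurd h' sy.1

open Classical in
lemma exists_small_degree (K : SC V) (hS : IsSphere2 K) :
    ∃ v : V, (Finset.univ.filter fun t => K.Adj t v).card ≤ 5 := by
  by_contra hcon
  push Not at hcon
  obtain ⟨h1, -, -, h4, -, -, h7⟩ := hS
  let E : Finset (Finset V) := Finset.univ.filter fun s => s ∈ K.faces ∧ s.card = 2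
  let F : Finset (Finset V) := Finset.univ.filter fun s => s ∈ K.faces ∧ s.card = 3
  have mE : ∀ s, s ∈ E ↔ s ∈ K.faces ∧ s.card = 2 := fun s => by simp [E]
  have mF : ∀ s, s ∈ F ↔ s ∈ K.faces ∧ s.card = 3 := fun s => by simp [F]
  have c2 : Set.ncard {s | s ∈ K.faces ∧ s.card = 2} = E.card := by
    rw [← Set.ncard_coe_finset]; congr 1; ext s; simp [mE]
  have c3 : Set.ncard {s | s ∈ K.faces ∧ s.card = 3} = F.card := by
    rw [← Set.ncard_coe_finset]; congr 1; ext s; simp [mF]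
  have c1 : Set.ncard {s | s ∈ K.faces ∧ s.card = 1} = Fintype.card V := by
    have : {s | s ∈ K.faces ∧ s.card = 1} = (fun v : V => ({v} : Finset V)) '' Set.univ := by
      ext s
      simp only [Set.mem_setOf_eq, Set.image_univ, Set.mem_range]
      constructor
      · rintro ⟨_, hs⟩
        obtain ⟨v, rfl⟩ := Finset.card_eq_one.1 hs
        exact ⟨v, rfl⟩
      · rintro ⟨v, rfl⟩
        exact ⟨h1 v, by simp⟩
    rw [this, Set.ncard_image_of_injective _ Finset.singleton_injective, Set.ncard_univ,
      Nat.card_eq_fintype_card]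
  have d1 := Finset.sum_card_bipartiteAbove_eq_sum_card_bipartiteBelow
    (s := E) (t := F) (fun e t => e ⊆ t)
  have d2 : ∀ e ∈ E, (Finset.bipartiteAbove (fun e t : Finset V => e ⊆ t) F e).card = 2 := by
    intro e he
    rw [mE] at he
    rw [← h4 e he.1 he.2, ← Set.ncard_coe_finset]
    congr 1; ext t; simp [Finset.bipartiteAbove, mF, and_assoc]
  have d3 : ∀ t ∈ F, (Finset.bipartiteBelow (fun e t : Finset V => e ⊆ t) E t).card = 3 := by
    intro t ht
    rw [mF] at ht
    have : Finset.bipartiteBelow (fun e t : Finset V => e ⊆ t) E t = t.powersetCard 2 := by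
      ext e
      rw [Finset.bipartiteBelow, Finset.mem_filter, mE, Finset.mem_powersetCard]
      exact ⟨fun h => ⟨h.2, h.1.2⟩, fun h => ⟨⟨K.down_closed t ht.1 e h.1, h.2⟩, h.1⟩⟩
    rw [this, Finset.card_powersetCard, ht.2]; rfl
  rw [Finset.sum_congr rfl d2, Finset.sum_congr rfl d3, Finset.sum_const, Finset.sum_const,
    smul_eq_mul, smul_eq_mul] at d1
  have g1 := Finset.sum_card_bipartiteAbove_eq_sum_card_bipartiteBelow
    (s := (Finset.univ : Finset V)) (t := E) (fun v e => v ∈ e)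
  have g2 : ∀ v ∈ (Finset.univ : Finset V),
      6 ≤ (Finset.bipartiteAbove (fun (v : V) (e : Finset V) => v ∈ e) E v).card := by
    intro v _
    refine le_trans (hcon v) ?_
    refine Finset.card_le_card_of_injOn (fun t => {v, t}) ?_ ?_
    · intro t ht
      have ht' : K.Adj t v := by simpa using ht
      have : ({v, t} : Finset V) ∈ E := (mE _).2 ⟨ht'.symm.face, Finset.card_pair ht'.1.symm⟩
      simp [Finset.bipartiteAbove, this]
    · intro s hs t ht hst
      have hs' : K.Adj s v := by simpa using hs
      have hm : s ∈ ({v, t} : Finset V) := by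
        have hst' : ({v, s} : Finset V) = {v, t} := hst
        rw [← hst']; simp
      simp only [Finset.mem_insert, Finset.mem_singleton] at hm
      rcases hm with h | h
      · exact absurd h hs'.1
      · exact h
  have g3 : ∀ e ∈ E, (Finset.bipartiteBelow (fun (v : V) (e : Finset V) => v ∈ e)
      (Finset.univ : Finset V) e).card = 2 := by
    intro e he
    rw [mE] at he
    rw [← he.2]
    congr 1; ext t; simp [Finset.bipartiteBelow]
  have g4 := Finset.sum_le_sum g2
  rw [g1, Finset.sum_congr rfl g3, Finset.sum_const, Finset.sum_const, smul_eq_mul, smul_eq_mul,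
    Finset.card_univ] at g4
  rw [c1, c2, c3] at h7
  omega

end SphereFacts

/-- For any Pogorelov polytope `P` (encoded by its dual simplicial 2-sphere `K`),
there is a nontrivial triple Massey product `⟨α, β, γ⟩ ⊆ H^{n+4}(Z_P)` for some
`n ≥ 5`, with `α ∈ H⁴(Z_P)`, `β ∈ H^{n-2}(Z_P)`, `γ ∈ H³(Z_P)`: there are cocycles
`a, b, c` of `R*(K)` (the cellular cochain model of the moment-angle manifold `Z_P`)
of total degrees `4`, `n-2`, `3` whose pairwise products `ab`, `bc` are coboundaries,
such that the Massey set contains a (homogeneous, degree `n+4`) element and does not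
contain `0`.  (The existence of a nontrivial Massey product implies that `Z_P` is
not formal.) -/
theorem stmt15 {V : Type} [LinearOrder V] [Fintype V] (K : SC V)
    (hS : IsSphere2 K) (hP : IsPogorelov K) :
    ∃ n : ℕ, 5 ≤ n ∧
      ∃ a b c : RK K,
        dR K a = 0 ∧ dR K b = 0 ∧ dR K c = 0 ∧
        homogTotal K a 4 ∧ homogTotal K b (n - 2) ∧ homogTotal K c 3 ∧
        (∃ w₁ : RK K, dR K w₁ = mulR K a b) ∧ (∃ w₂ : RK K, dR K w₂ = mulR K b c) ∧
        (∃ z ∈ MasseySet K 4 a b c, homogTotal K z (n + 4)) ∧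
        (0 : RK K) ∉ MasseySet K 4 a b c := by
  have hcom := common_two K hS hP.1
  obtain ⟨v, hv⟩ := exists_small_degree K hS
  obtain ⟨s, hs, hvs, hc⟩ := hS.2.2.1 {v} (hS.1 v)
  obtain ⟨p3, hp3, hne⟩ : ∃ p ∈ s, p ≠ v := Finset.exists_mem_ne (by omega) v
  have hv3 : K.Adj v p3 := ⟨hne.symm, s, hs, hvs (by simp), hp3⟩
  obtain ⟨A, B, C, p0, p1, p2, p3, p4, h1, h2, h3, h4, h5, h6, h7, h8, h9, h10, h11, h12, h13,
    h14, h15, h16, h17, h18, h19, h20, h21, h22, h23, h24⟩ :=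
    exists_config K hcom (no_K4 K hS hP.1) (no_C4 K hP.2) v p3 hv3 hv
  exact massey_of_config K A B C p0 p1 p2 p3 p4 h1 h2 h3 h4 h5 h6 h7 h8 h9 h10 h11 h12 h13
    h14 h15 h16 h17 h18 h19 h20 h21 h22 h23 h24
end
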